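/- arXiv:2008.11501 — 7 statements merged into one kernel-verified Lean document; each statement's English description precedes it below -/
import Mathlib

section
/- Let A, D ∈ ℂ^{n×n} and let p be any polynomial with complex coefficients. Then p evaluated at the block upper triangular matrix [[A, D], [0, A+D]] (of size 2n) equals [[p(A), p(A+D) − p(A)], [0, p(A+D)]]; in particular, the (1,2) block of p([[A, D], [0, A+D]]) equals p(A+D) − p(A). -/
open Polynomial Matrix

/-- For `A, D : Matrix (Fin n) (Fin n) ℂ` and any polynomial `p` over `ℂ`,
`p([[A, D], [0, A+D]]) = [[p(A), p(A+D) - p(A)], [0, p(A+D)]]`; in particular the (1,2)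
block of `p([[A, D], [0, A+D]])` equals `p(A+D) - p(A)`. -/
theorem stmt0 (n : ℕ) (A D : Matrix (Fin n) (Fin n) ℂ) (p : Polynomial ℂ) :
    aeval (Matrix.fromBlocks A D 0 (A + D)) p =
      Matrix.fromBlocks (aeval A p) (aeval (A + D) p - aeval A p) 0 (aeval (A + D) p) ∧
    (aeval (Matrix.fromBlocks A D 0 (A + D)) p).toBlocks₁₂ =
      aeval (A + D) p - aeval A p := by
  have h : aeval (Matrix.fromBlocks A D 0 (A + D)) p =
      Matrix.fromBlocks (aeval A p) (aeval (A + D) p - aeval A p) 0 (aeval (A + D) p) := by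
    induction p using Polynomial.induction_on with
    | C a =>
      simp only [aeval_C, sub_self, Algebra.algebraMap_eq_smul_one]
      rw [← Matrix.fromBlocks_one, Matrix.fromBlocks_smul, smul_zero]
    | add p q hp hq =>
      simp only [map_add, hp, hq, Matrix.fromBlocks_add, add_zero]
      congr 1
      abel
    | monomial k a ih =>
      rw [pow_succ, ← mul_assoc]
      generalize C a * X ^ k = q at ih ⊢
      simp only [map_mul, aeval_X, ih, Matrix.fromBlocks_multiply, mul_zero, zero_mul,
        add_zero, zero_add]
      congr 1
      noncomm_ring
  exact ⟨h, by rw [h, Matrix.toBlocks_fromBlocks₁₂]⟩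
end

section
/- Let A ∈ ℂ^{n×n}, Q ∈ ℂ^{n×ℓ}, and let U ∈ ℂ^{n×k} be an orthonormal basis of the block Krylov subspace K_m(A, Q). Then for every polynomial p of degree at most m−1 one has p(A) Q = U p(U* A U) U* Q. -/
open Polynomial Matrix

/-- The block Krylov subspace `K_m(A, B)`: the span of the columns of
`B, A*B, …, A^(m-1)*B`. -/
noncomputable def Krylov {n : ℕ} {ι : Type*} (m : ℕ) (A : Matrix (Fin n) (Fin n) ℂ)
    (B : Matrix (Fin n) ι ℂ) : Submodule ℂ (Fin n → ℂ) :=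
  Submodule.span ℂ {v | ∃ i < m, ∃ j, v = (A ^ i * B)ᵀ j}

/-- `U` is an orthonormal basis of the subspace `S` if `Uᴴ U = 1` and the columns of `U`
span `S`. -/
def IsOrthonormalBasisOf {n k : ℕ} (U : Matrix (Fin n) (Fin k) ℂ)
    (S : Submodule ℂ (Fin n → ℂ)) : Prop :=
  Uᴴ * U = 1 ∧ Submodule.span ℂ (Set.range Uᵀ) = S

/-- If `U` is an orthonormal basis of the block Krylov subspace `K_m(A, Q)`,
then for every polynomial `p` of degree at most `m - 1`,
`p(A) Q = U p(Uᴴ A U) Uᴴ Q`. -/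
theorem stmt3 (n ℓ k m : ℕ) (A : Matrix (Fin n) (Fin n) ℂ) (Q : Matrix (Fin n) (Fin ℓ) ℂ)
    (U : Matrix (Fin n) (Fin k) ℂ) (hU : IsOrthonormalBasisOf U (Krylov m A Q)) :
    ∀ p : Polynomial ℂ, p.degree < (m : ℕ) →
      aeval A p * Q = U * aeval (Uᴴ * A * U) p * Uᴴ * Q := by
  intro p hp
  obtain ⟨h1, h2⟩ := hU
  have hproj : ∀ v ∈ Krylov m A Q, (U * Uᴴ) *ᵥ v = v := by
    intro v hv
    rw [← h2] at hv
    induction hv using Submodule.span_induction with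
    | mem x hx =>
      obtain ⟨j, rfl⟩ := hx
      have h3 : (U * Uᴴ) * U = U := by rw [Matrix.mul_assoc, h1, Matrix.mul_one]
      funext a
      exact congrFun (congrFun h3 a) j
    | zero => simp
    | add x y _ _ hx hy => rw [Matrix.mulVec_add, hx, hy]
    | smul c x _ hx => rw [Matrix.mulVec_smul, hx]
  have hP : ∀ i < m, (U * Uᴴ) * (A ^ i * Q) = A ^ i * Q := by
    intro i hi
    ext a j
    exact congrFun (hproj ((A ^ i * Q)ᵀ j) (Submodule.subset_span ⟨i, hi, j, rfl⟩)) a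
  have hpow : ∀ i < m, A ^ i * Q = U * (Uᴴ * A * U) ^ i * Uᴴ * Q := by
    intro i
    induction i with
    | zero =>
      intro hi
      have h := hP 0 hi
      simp only [pow_zero, Matrix.one_mul, Matrix.mul_one] at h ⊢
      exact h.symm
    | succ i ih =>
      intro hi
      rw [← hP (i + 1) hi, pow_succ', Matrix.mul_assoc A, ih (by omega), pow_succ']
      simp only [Matrix.mul_assoc]
  by_cases h0 : p = 0
  · simp [h0]
  have hd : p.natDegree < m := (Polynomial.natDegree_lt_iff_degree_lt h0).2 hp
  rw [Polynomial.aeval_eq_sum_range' hd, Polynomial.aeval_eq_sum_range' hd]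
  simp only [Matrix.sum_mul, Matrix.mul_sum, Matrix.smul_mul, Matrix.mul_smul]
  refine Finset.sum_congr rfl fun i hi => ?_
  rw [hpow i (Finset.mem_range.1 hi)]
end

section
/- Let A ∈ ℂ^{n×n}, B ∈ ℂ^{n×ℓ}, let ξ_1,…,ξ_m ∈ ℂ be such that q_m(A) is invertible, where q_m(z) = (z−ξ_1)⋯(z−ξ_m), and let U ∈ ℂ^{n×k} be an orthonormal basis of the rational Krylov subspace q_m(A)^{−1}K_m(A,B). If p is a polynomial of degree at most m−1 and q_m(U*AU) is invertible, then p(A) q_m(A)^{−1} B = U p(U*AU) q_m(U*AU)^{−1} U* B. -/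
open Polynomial Matrix

/-- The rational Krylov subspace `q_m(A)⁻¹ K_m(A, B)`. -/
noncomputable def ratKrylov {n : ℕ} {ι : Type*} (m : ℕ) (ξ : Fin m → ℂ)
    (A : Matrix (Fin n) (Fin n) ℂ) (B : Matrix (Fin n) ι ℂ) : Submodule ℂ (Fin n → ℂ) :=
  (Krylov m A B).map ((aeval A (∏ i, (X - C (ξ i))))⁻¹).mulVecLin

theorem krylov_proj {n ℓ k m : ℕ} {A : Matrix (Fin n) (Fin n) ℂ} {B : Matrix (Fin n) (Fin ℓ) ℂ}
    {ξ : Fin m → ℂ} {U : Matrix (Fin n) (Fin k) ℂ} (hq : IsUnit (aeval A (∏ i, (X - C (ξ i)))))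
    (hU : IsOrthonormalBasisOf U (ratKrylov m ξ A B)) (i : ℕ) (hi : i < m) :
    U * (Uᴴ * (A ^ i * ((aeval A (∏ i, (X - C (ξ i))))⁻¹ * B))) =
      A ^ i * ((aeval A (∏ i, (X - C (ξ i))))⁻¹ * B) := by
  obtain ⟨h1, h2⟩ := hU
  set Q := aeval A (∏ i, (X - C (ξ i))) with hQ
  have hc : A ^ i * Q⁻¹ = Q⁻¹ * A ^ i := by
    have h : Commute A Q := by
      have := (Commute.all (X : ℂ[X]) (∏ i, (X - C (ξ i)))).map (aeval A)
      simpa [hQ] using this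
    have h' := h.pow_left i
    have hd := (Matrix.isUnit_iff_isUnit_det _).mp hq
    calc A ^ i * Q⁻¹ = Q⁻¹ * (Q * A ^ i) * Q⁻¹ := by
          rw [Matrix.nonsing_inv_mul_cancel_left _ _ hd]
      _ = Q⁻¹ * A ^ i := by
          rw [← h'.eq, ← Matrix.mul_assoc, Matrix.mul_nonsing_inv_cancel_right _ _ hd]
  rw [← Matrix.mul_assoc (A ^ i), hc, Matrix.mul_assoc Q⁻¹]
  have hcol : ∀ j, ∃ w, U *ᵥ w = (Q⁻¹ * (A ^ i * B))ᵀ j := by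
    intro j
    have : (Q⁻¹ * (A ^ i * B))ᵀ j ∈ Submodule.span ℂ (Set.range Uᵀ) := by
      rw [h2]
      refine ⟨(A ^ i * B)ᵀ j, Submodule.subset_span ⟨i, hi, j, rfl⟩, ?_⟩
      ext a
      rfl
    have h3 : Submodule.span ℂ (Set.range Uᵀ) = LinearMap.range U.mulVecLin :=
      (Matrix.range_mulVecLin U).symm
    rw [h3] at this
    exact this
  choose w hw using hcol
  have hW : Q⁻¹ * (A ^ i * B) = U * (Matrix.of w)ᵀ := by
    ext a j
    exact (congrFun (hw j) a).symm
  rw [hW, ← Matrix.mul_assoc Uᴴ, h1, Matrix.one_mul]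

theorem krylov_pow {n ℓ k m : ℕ} {A : Matrix (Fin n) (Fin n) ℂ} {Y : Matrix (Fin n) (Fin ℓ) ℂ}
    {U : Matrix (Fin n) (Fin k) ℂ}
    (h : ∀ i < m, U * (Uᴴ * (A ^ i * Y)) = A ^ i * Y) (i : ℕ) (hi : i ≤ m) :
    Uᴴ * (A ^ i * Y) = (Uᴴ * A * U) ^ i * (Uᴴ * Y) := by
  induction i with
  | zero => simp
  | succ i ih =>
    rw [pow_succ', pow_succ', Matrix.mul_assoc A, ← h i hi, ih (by omega)]
    simp only [Matrix.mul_assoc]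

theorem krylov_poly {n ℓ k m : ℕ} {A : Matrix (Fin n) (Fin n) ℂ} {Y : Matrix (Fin n) (Fin ℓ) ℂ}
    {U : Matrix (Fin n) (Fin k) ℂ}
    (h : ∀ i < m, U * (Uᴴ * (A ^ i * Y)) = A ^ i * Y) (r : ℂ[X]) (hr : r.natDegree ≤ m) :
    Uᴴ * (aeval A r * Y) = aeval (Uᴴ * A * U) r * (Uᴴ * Y) := by
  rw [aeval_eq_sum_range, aeval_eq_sum_range, Matrix.sum_mul, Matrix.sum_mul, Matrix.mul_sum]
  refine Finset.sum_congr rfl fun i hi => ?_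
  rw [Finset.mem_range] at hi
  rw [Matrix.smul_mul, Matrix.smul_mul, Matrix.mul_smul, krylov_pow h i (by omega)]

theorem krylov_proj_poly {n ℓ k m : ℕ} {A : Matrix (Fin n) (Fin n) ℂ}
    {Y : Matrix (Fin n) (Fin ℓ) ℂ} {U : Matrix (Fin n) (Fin k) ℂ}
    (h : ∀ i < m, U * (Uᴴ * (A ^ i * Y)) = A ^ i * Y) (r : ℂ[X]) (hr : r.degree < (m : ℕ)) :
    U * (Uᴴ * (aeval A r * Y)) = aeval A r * Y := by
  rw [aeval_eq_sum_range, Matrix.sum_mul, Matrix.mul_sum, Matrix.mul_sum]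
  refine Finset.sum_congr rfl fun i _ => ?_
  rw [Matrix.smul_mul, Matrix.mul_smul, Matrix.mul_smul]
  by_cases hi : i < m
  · rw [h i hi]
  · rw [coeff_eq_zero_of_degree_lt (hr.trans_le (by exact_mod_cast not_lt.mp hi)), zero_smul,
      zero_smul]

/-- Let `q_m(z) = (z-ξ₁)⋯(z-ξ_m)` with `q_m(A)` invertible, and let `U` be an
orthonormal basis of the rational Krylov subspace `q_m(A)⁻¹ K_m(A, B)`. If `p` has degree
at most `m-1` and `q_m(Uᴴ A U)` is invertible, then
`p(A) q_m(A)⁻¹ B = U p(Uᴴ A U) q_m(Uᴴ A U)⁻¹ Uᴴ B`. -/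
theorem stmt4 (n ℓ k m : ℕ) (A : Matrix (Fin n) (Fin n) ℂ) (B : Matrix (Fin n) (Fin ℓ) ℂ)
    (ξ : Fin m → ℂ) (hq : IsUnit (aeval A (∏ i, (X - C (ξ i)))))
    (U : Matrix (Fin n) (Fin k) ℂ) (hU : IsOrthonormalBasisOf U (ratKrylov m ξ A B))
    (p : Polynomial ℂ) (hp : p.degree < (m : ℕ))
    (hqG : IsUnit (aeval (Uᴴ * A * U) (∏ i, (X - C (ξ i))))) :
    aeval A p * (aeval A (∏ i, (X - C (ξ i))))⁻¹ * B =
      U * aeval (Uᴴ * A * U) p * (aeval (Uᴴ * A * U) (∏ i, (X - C (ξ i))))⁻¹ * Uᴴ * B := by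
  have h := fun i hi => krylov_proj hq hU i hi
  have hdeg : (∏ i, (X - C (ξ i))).natDegree ≤ m := by
    rw [natDegree_finsetProd_X_sub_C_eq_card]
    simp
  have h1 := krylov_poly h _ hdeg
  have h2 := krylov_poly h p (natDegree_le_of_degree_le hp.le)
  have h3 := krylov_proj_poly h p hp
  rw [Matrix.mul_nonsing_inv_cancel_left _ _ ((Matrix.isUnit_iff_isUnit_det _).mp hq)] at h1
  simp only [Matrix.mul_assoc] at h1 h2 h3 hqG ⊢
  rw [h1, Matrix.nonsing_inv_mul_cancel_left _ _ ((Matrix.isUnit_iff_isUnit_det _).mp hqG),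
    ← h2, h3]
end

section
/- Let A ∈ ℂ^{n×n}, B, C ∈ ℂ^{n×ℓ}, and let q_m(z) = (z−ξ_1)⋯(z−ξ_m) with ξ_1,…,ξ_m ∈ ℂ. Let U be an orthonormal basis of q_m(A)^{−1}K_m(A,B) and V be an orthonormal basis of \bar q_m(A*)^{−1}K_m(A*,C), where \bar q_m(z) = (z−\bar ξ_1)⋯(z−\bar ξ_m). Set G = U*AU, H = V*A*V, and T = [[G, (U*B)(V*C)*], [0, H* + (V*B)(V*C)*]]. Let p be a polynomial of degree at most m and assume that q_m(A), q_m(A+BC*), q_m(G), and q_m(H* + (V*B)(V*C)*) are invertible, so that r(M) := p(M) q_m(M)^{−1} is well defined for M ∈ {A, A+BC*, G, H*+(V*B)(V*C)*} and for T. Then r(A+BC*) − r(A) = U X V*, where X is the (1,2) block (of size k_U × k_V) of r(T). -/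
open Polynomial Matrix

section helpers

variable {ι κ ι' κ' : Type} [Fintype ι] [Fintype κ] [Fintype ι'] [Fintype κ']
  [DecidableEq ι] [DecidableEq κ] [DecidableEq ι'] [DecidableEq κ']

noncomputable def tauMap (P : Matrix ι ι ℂ) (N : Matrix ι κ ℂ) (Q : Matrix κ κ ℂ) :
    ℂ[X] →ₗ[ℂ] Matrix ι κ ℂ where
  toFun f := (aeval (Matrix.fromBlocks P N 0 Q) f).toBlocks₁₂
  map_add' f g := by ext i j; simp [Matrix.toBlocks₁₂]
  map_smul' c f := by ext i j; simp [Matrix.toBlocks₁₂]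

lemma aeval_blocks (P : Matrix ι ι ℂ) (N : Matrix ι κ ℂ) (Q : Matrix κ κ ℂ) (f : ℂ[X]) :
    aeval (Matrix.fromBlocks P N 0 Q) f =
      Matrix.fromBlocks (aeval P f) (tauMap P N Q f) 0 (aeval Q f) := by
  have key : ∃ Y, aeval (Matrix.fromBlocks P N 0 Q) f =
      Matrix.fromBlocks (aeval P f) Y 0 (aeval Q f) := by
    induction f using Polynomial.induction_on with
    | C a =>
      refine ⟨0, ?_⟩
      simp only [aeval_C, Algebra.algebraMap_eq_smul_one]
      rw [← Matrix.fromBlocks_one, Matrix.fromBlocks_smul]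
      simp
    | add f g hf hg =>
      obtain ⟨Y, hY⟩ := hf
      obtain ⟨Z, hZ⟩ := hg
      exact ⟨Y + Z, by simp only [map_add, hY, hZ, Matrix.fromBlocks_add, add_zero]⟩
    | monomial k a h =>
      obtain ⟨Y, hY⟩ := h
      refine ⟨aeval P (Polynomial.C a * X ^ k) * N + Y * Q, ?_⟩
      rw [pow_succ, ← mul_assoc, map_mul, hY, map_mul (aeval P) _ X, map_mul (aeval Q) _ X,
        aeval_X, aeval_X, aeval_X, Matrix.fromBlocks_multiply]
      simp
  obtain ⟨Y, hY⟩ := key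
  have : tauMap P N Q f = Y := by
    simp only [tauMap, LinearMap.coe_mk, AddHom.coe_mk, hY, Matrix.toBlocks_fromBlocks₁₂]
  rw [this, hY]

lemma tau_mul (P : Matrix ι ι ℂ) (N : Matrix ι κ ℂ) (Q : Matrix κ κ ℂ) (f g : ℂ[X]) :
    tauMap P N Q (f * g) = aeval P f * tauMap P N Q g + tauMap P N Q f * aeval Q g := by
  have h := aeval_blocks P N Q (f * g)
  rw [map_mul, aeval_blocks P N Q f, aeval_blocks P N Q g, Matrix.fromBlocks_multiply] at h
  exact ((Matrix.fromBlocks_inj.1 h).2.1).symm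

lemma tau_X (P : Matrix ι ι ℂ) (N : Matrix ι κ ℂ) (Q : Matrix κ κ ℂ) :
    tauMap P N Q X = N := by
  simp [tauMap]

lemma tau_one (P : Matrix ι ι ℂ) (N : Matrix ι κ ℂ) (Q : Matrix κ κ ℂ) :
    tauMap P N Q 1 = 0 := by
  simp [tauMap, ← Matrix.fromBlocks_one]

lemma tau_sub (P Q : Matrix ι ι ℂ) (f : ℂ[X]) :
    tauMap P (Q - P) Q f = aeval Q f - aeval P f := by
  induction f using Polynomial.induction_on with
  | C a =>
    have : (Polynomial.C a : ℂ[X]) = a • 1 := by rw [Polynomial.smul_eq_C_mul, mul_one]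
    rw [this, map_smul, tau_one]; simp
  | add f g hf hg => simp only [map_add, hf, hg]; abel
  | monomial k a h =>
    rw [pow_succ, ← mul_assoc, tau_mul, h, tau_X, map_mul (aeval P) _ X, map_mul (aeval Q) _ X,
      aeval_X, aeval_X]
    noncomm_ring

/-- The Bezoutian expression. -/
noncomputable def bez (P : Matrix ι ι ℂ) (N : Matrix ι κ ℂ) (Q : Matrix κ κ ℂ) (f g : ℂ[X]) :
    Matrix ι κ ℂ :=
  aeval P f * tauMap P N Q g - aeval P g * tauMap P N Q f

lemma bez_swap (P : Matrix ι ι ℂ) (N : Matrix ι κ ℂ) (Q : Matrix κ κ ℂ) (f g : ℂ[X]) :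
    bez P N Q f g = - bez P N Q g f := by
  simp [bez]

lemma bez_mono (P : Matrix ι ι ℂ) (N : Matrix ι κ ℂ) (Q : Matrix κ κ ℂ) (a d : ℕ) :
    bez P N Q (X ^ a) (X ^ (d + a)) = P ^ a * tauMap P N Q (X ^ d) * Q ^ a := by
  rw [bez, pow_add, tau_mul]
  simp only [map_mul, map_pow, aeval_X]
  rw [Matrix.mul_add, ← Matrix.mul_assoc, ← Matrix.mul_assoc, ← pow_add, ← pow_add, add_comm a d]
  simp

variable {Z : Type} [AddCommGroup Z] [Module ℂ Z]

lemma phi_tau (m : ℕ) (P : Matrix ι ι ℂ) (N : Matrix ι κ ℂ) (Q : Matrix κ κ ℂ)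
    (P' : Matrix ι' ι' ℂ) (N' : Matrix ι' κ' ℂ) (Q' : Matrix κ' κ' ℂ)
    (Φ : Matrix ι κ ℂ →ₗ[ℂ] Z) (Φ' : Matrix ι' κ' ℂ →ₗ[ℂ] Z)
    (h : ∀ i < m, ∀ j < m, Φ (P ^ i * N * Q ^ j) = Φ' (P' ^ i * N' * Q' ^ j)) (d : ℕ) :
    ∀ s t, s + d ≤ m → t + d ≤ m → Φ (P ^ s * tauMap P N Q (X ^ d) * Q ^ t) =
      Φ' (P' ^ s * tauMap P' N' Q' (X ^ d) * Q' ^ t) := by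
  induction d with
  | zero => intro s t _ _; simp [tau_one]
  | succ d ih =>
    intro s t hs ht
    have e1 : P ^ s * tauMap P N Q (X ^ (d + 1)) * Q ^ t =
        P ^ (s + 1) * tauMap P N Q (X ^ d) * Q ^ t + P ^ s * N * Q ^ (d + t) := by
      rw [pow_succ' X d, tau_mul, tau_X, aeval_X, aeval_X_pow, pow_succ, pow_add]
      simp only [Matrix.mul_add, Matrix.add_mul, Matrix.mul_assoc]
    have e2 : P' ^ s * tauMap P' N' Q' (X ^ (d + 1)) * Q' ^ t =
        P' ^ (s + 1) * tauMap P' N' Q' (X ^ d) * Q' ^ t + P' ^ s * N' * Q' ^ (d + t) := by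
      rw [pow_succ' X d, tau_mul, tau_X, aeval_X, aeval_X_pow, pow_succ, pow_add]
      simp only [Matrix.mul_add, Matrix.add_mul, Matrix.mul_assoc]
    rw [e1, e2, map_add, map_add, ih (s + 1) t (by omega) (by omega),
      h s (by omega) (d + t) (by omega)]

lemma phi_bez (m : ℕ) (P : Matrix ι ι ℂ) (N : Matrix ι κ ℂ) (Q : Matrix κ κ ℂ)
    (P' : Matrix ι' ι' ℂ) (N' : Matrix ι' κ' ℂ) (Q' : Matrix κ' κ' ℂ)
    (Φ : Matrix ι κ ℂ →ₗ[ℂ] Z) (Φ' : Matrix ι' κ' ℂ →ₗ[ℂ] Z)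
    (h : ∀ i < m, ∀ j < m, Φ (P ^ i * N * Q ^ j) = Φ' (P' ^ i * N' * Q' ^ j))
    (f g : ℂ[X]) (hf : f.degree ≤ (m : ℕ)) (hg : g.degree ≤ (m : ℕ)) :
    Φ (bez P N Q f g) = Φ' (bez P' N' Q' f g) := by
  have hle : ∀ a c, a ≤ c → c ≤ m →
      Φ (bez P N Q (X ^ a) (X ^ c)) = Φ' (bez P' N' Q' (X ^ a) (X ^ c)) := by
    intro a c hac hc
    obtain ⟨d, rfl⟩ := Nat.exists_eq_add_of_le' hac
    rw [bez_mono, bez_mono]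
    exact phi_tau m P N Q P' N' Q' Φ Φ' h d a a (by omega) (by omega)
  have hall : ∀ a c, a ≤ m → c ≤ m →
      Φ (bez P N Q (X ^ a) (X ^ c)) = Φ' (bez P' N' Q' (X ^ a) (X ^ c)) := by
    intro a c ha hc
    rcases le_total a c with hac | hac
    · exact hle a c hac hc
    · rw [bez_swap, bez_swap P', map_neg, map_neg, hle c a hac ha]
  have hX : ∀ f : ℂ[X], f.degree ≤ (m : ℕ) →
      f ∈ Submodule.span ℂ (((Finset.range (m + 1)).image fun n => (X : ℂ[X]) ^ n : Finset ℂ[X]) :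
        Set ℂ[X]) := by
    intro f hf
    rw [← Polynomial.degreeLE_eq_span_X_pow]
    exact Polynomial.mem_degreeLE.2 hf
  have step : ∀ a ≤ m, Φ (bez P N Q (X ^ a) g) = Φ' (bez P' N' Q' (X ^ a) g) := by
    intro a ha
    have hmem := hX g hg
    clear hg
    induction hmem using Submodule.span_induction with
    | mem x hx =>
      simp only [Finset.coe_image, Set.mem_image, Finset.coe_range, Set.mem_Iio] at hx
      obtain ⟨c, hc, rfl⟩ := hx
      exact hall a c ha (by omega)
    | zero => simp [bez]
    | add x y _ _ hx hy =>
      have e1 : bez P N Q (X ^ a) (x + y) = bez P N Q (X ^ a) x + bez P N Q (X ^ a) y := by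
        simp only [bez, map_add, Matrix.mul_add, Matrix.add_mul]; abel
      have e2 : bez P' N' Q' (X ^ a) (x + y) = bez P' N' Q' (X ^ a) x + bez P' N' Q' (X ^ a) y := by
        simp only [bez, map_add, Matrix.mul_add, Matrix.add_mul]; abel
      rw [e1, e2, map_add, map_add, hx, hy]
    | smul c x _ hx =>
      have e1 : bez P N Q (X ^ a) (c • x) = c • bez P N Q (X ^ a) x := by
        simp only [bez, map_smul, Matrix.mul_smul, Matrix.smul_mul, smul_sub]
      have e2 : bez P' N' Q' (X ^ a) (c • x) = c • bez P' N' Q' (X ^ a) x := by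
        simp only [bez, map_smul, Matrix.mul_smul, Matrix.smul_mul, smul_sub]
      rw [e1, e2, map_smul, map_smul, hx]
  have hmem := hX f hf
  clear hf
  induction hmem using Submodule.span_induction with
  | mem x hx =>
    simp only [Finset.coe_image, Set.mem_image, Finset.coe_range, Set.mem_Iio] at hx
    obtain ⟨c, hc, rfl⟩ := hx
    exact step c (by omega)
  | zero => simp [bez]
  | add x y _ _ hx hy =>
    have e1 : bez P N Q (x + y) g = bez P N Q x g + bez P N Q y g := by
      simp only [bez, map_add, Matrix.mul_add, Matrix.add_mul]; abel
    have e2 : bez P' N' Q' (x + y) g = bez P' N' Q' x g + bez P' N' Q' y g := by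
      simp only [bez, map_add, Matrix.mul_add, Matrix.add_mul]; abel
    rw [e1, e2, map_add, map_add, hx, hy]
  | smul c x _ hx =>
    have e1 : bez P N Q (c • x) g = c • bez P N Q x g := by
      simp only [bez, map_smul, Matrix.mul_smul, Matrix.smul_mul, smul_sub]
    have e2 : bez P' N' Q' (c • x) g = c • bez P' N' Q' x g := by
      simp only [bez, map_smul, Matrix.mul_smul, Matrix.smul_mul, smul_sub]
    rw [e1, e2, map_smul, map_smul, hx]

lemma inv_comm_aeval (A : Matrix ι ι ℂ) (q f : ℂ[X]) :
    (aeval A q)⁻¹ * aeval A f = aeval A f * (aeval A q)⁻¹ := by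
  have : Commute (aeval A f) (aeval A q) := by
    rw [commute_iff_eq, ← map_mul, ← map_mul, mul_comm]
  have h := (Matrix.Commute.zpow_right this (-1)).eq
  rw [Matrix.zpow_neg_one] at h
  exact h.symm

lemma inv_comm_pow (A : Matrix ι ι ℂ) (q : ℂ[X]) (i : ℕ) :
    (aeval A q)⁻¹ * A ^ i = A ^ i * (aeval A q)⁻¹ := by
  simpa using inv_comm_aeval A q (X ^ i)

/-- Polynomial identity from monomials, left version. -/
lemma poly_left (m : ℕ) (A : Matrix ι ι ℂ) (W : Matrix ι κ ℂ) (U : Matrix ι ι' ℂ)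
    (G : Matrix ι' ι' ℂ) (hG : G = Uᴴ * A * U)
    (hW : ∀ i < m, U * Uᴴ * (A ^ i * W) = A ^ i * W) (f : ℂ[X]) (hf : f.degree ≤ (m : ℕ)) :
    Uᴴ * (aeval A f * W) = aeval G f * (Uᴴ * W) := by
  have hp : ∀ i ≤ m, Uᴴ * (A ^ i * W) = G ^ i * (Uᴴ * W) := by
    intro i
    induction i with
    | zero => simp
    | succ i ih =>
      intro hi
      rw [pow_succ', pow_succ', Matrix.mul_assoc G, ← ih (by omega), hG, Matrix.mul_assoc A,
        ← hW i (by omega)]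
      simp only [Matrix.mul_assoc]
      have := hW i (by omega)
      simp only [Matrix.mul_assoc] at this
      rw [this, this]
  have hmem : f ∈ Polynomial.degreeLE ℂ m := Polynomial.mem_degreeLE.2 hf
  rw [Polynomial.degreeLE_eq_span_X_pow] at hmem
  clear hf
  induction hmem using Submodule.span_induction with
  | mem x hx =>
    simp only [Finset.coe_image, Set.mem_image, Finset.coe_range, Set.mem_Iio] at hx
    obtain ⟨c, hc, rfl⟩ := hx
    simpa using hp c (by omega)
  | zero => simp
  | add x y _ _ hx hy => simp only [map_add, Matrix.mul_add, Matrix.add_mul, hx, hy]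
  | smul c x _ hx => simp only [map_smul, Matrix.mul_smul, Matrix.smul_mul, hx]

lemma poly_right (m : ℕ) (A : Matrix ι ι ℂ) (W : Matrix κ ι ℂ) (V : Matrix ι ι' ℂ)
    (K : Matrix ι' ι' ℂ) (hK : K = Vᴴ * A * V)
    (hW : ∀ i < m, W * A ^ i * (V * Vᴴ) = W * A ^ i) (f : ℂ[X]) (hf : f.degree ≤ (m : ℕ)) :
    W * aeval A f * V = W * V * aeval K f := by
  have hp : ∀ i ≤ m, W * A ^ i * V = W * V * K ^ i := by
    intro i
    induction i with
    | zero => simp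
    | succ i ih =>
      intro hi
      have := hW i (by omega)
      rw [pow_succ, pow_succ, ← Matrix.mul_assoc (W * V), ← ih (by omega), hK,
        ← Matrix.mul_assoc W]
      simp only [← Matrix.mul_assoc] at this ⊢
      rw [this]
  have hmem : f ∈ Polynomial.degreeLE ℂ m := Polynomial.mem_degreeLE.2 hf
  rw [Polynomial.degreeLE_eq_span_X_pow] at hmem
  clear hf
  induction hmem using Submodule.span_induction with
  | mem x hx =>
    simp only [Finset.coe_image, Set.mem_image, Finset.coe_range, Set.mem_Iio] at hx
    obtain ⟨c, hc, rfl⟩ := hx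
    simpa using hp c (by omega)
  | zero => simp
  | add x y _ _ hx hy => simp only [map_add, Matrix.mul_add, Matrix.add_mul, hx, hy]
  | smul c x _ hx => simp only [map_smul, Matrix.mul_smul, Matrix.smul_mul, hx]

/-- Rational exactness, left version. -/
lemma exact_left (m : ℕ) (A : Matrix ι ι ℂ) (B : Matrix ι κ ℂ) (U : Matrix ι ι' ℂ)
    (G : Matrix ι' ι' ℂ) (hG : G = Uᴴ * A * U) (q : ℂ[X]) (hq : q.degree ≤ (m : ℕ))
    (h1 : IsUnit (aeval A q)) (h3 : IsUnit (aeval G q))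
    (hW : ∀ i < m, U * Uᴴ * ((aeval A q)⁻¹ * (A ^ i * B)) = (aeval A q)⁻¹ * (A ^ i * B))
    (i : ℕ) (hi : i < m) :
    (aeval A q)⁻¹ * (A ^ i * B) = U * ((aeval G q)⁻¹ * (G ^ i * (Uᴴ * B))) := by
  have d1 := (Matrix.isUnit_iff_isUnit_det _).1 h1
  have d3 := (Matrix.isUnit_iff_isUnit_det _).1 h3
  have hc : ∀ i, (aeval A q)⁻¹ * (A ^ i * B) = A ^ i * ((aeval A q)⁻¹ * B) := by
    intro i
    rw [← Matrix.mul_assoc, inv_comm_pow, Matrix.mul_assoc]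
  have hW' : ∀ i < m, U * Uᴴ * (A ^ i * ((aeval A q)⁻¹ * B)) = A ^ i * ((aeval A q)⁻¹ * B) := by
    intro i hi
    rw [← hc]; exact hW i hi
  have k1 := poly_left m A _ U G hG hW' q hq
  rw [Matrix.mul_nonsing_inv_cancel_left _ _ d1] at k1
  have k2 := poly_left m A _ U G hG hW' (X ^ i) (by
    rw [degree_X_pow]; exact_mod_cast hi.le)
  simp only [map_pow, aeval_X] at k2
  rw [k1, ← Matrix.mul_assoc (aeval G q)⁻¹, inv_comm_pow, Matrix.mul_assoc,
    Matrix.nonsing_inv_mul_cancel_left _ _ d3, ← k2, hc, ← Matrix.mul_assoc U, hW' i hi]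

lemma exact_right (m : ℕ) (A : Matrix ι ι ℂ) (D : Matrix κ ι ℂ) (V : Matrix ι ι' ℂ)
    (K : Matrix ι' ι' ℂ) (hK : K = Vᴴ * A * V) (q : ℂ[X]) (hq : q.degree ≤ (m : ℕ))
    (h1 : IsUnit (aeval A q)) (h3 : IsUnit (aeval K q))
    (hW : ∀ i < m, D * A ^ i * (aeval A q)⁻¹ * (V * Vᴴ) = D * A ^ i * (aeval A q)⁻¹)
    (i : ℕ) (hi : i < m) :
    D * A ^ i * (aeval A q)⁻¹ = D * V * K ^ i * (aeval K q)⁻¹ * Vᴴ := by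
  have d1 := (Matrix.isUnit_iff_isUnit_det _).1 h1
  have d3 := (Matrix.isUnit_iff_isUnit_det _).1 h3
  have hc : ∀ i, D * A ^ i * (aeval A q)⁻¹ = D * (aeval A q)⁻¹ * A ^ i := by
    intro i
    rw [Matrix.mul_assoc, ← inv_comm_pow, Matrix.mul_assoc]
  have hW' : ∀ i < m, D * (aeval A q)⁻¹ * A ^ i * (V * Vᴴ) = D * (aeval A q)⁻¹ * A ^ i := by
    intro i hi
    rw [← hc]; exact hW i hi
  have k1 := poly_right m A _ V K hK hW' q hq
  rw [Matrix.nonsing_inv_mul_cancel_right _ _ d1] at k1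
  have k2 := poly_right m A _ V K hK hW' (X ^ i) (by
    rw [degree_X_pow]; exact_mod_cast hi.le)
  simp only [map_pow, aeval_X] at k2
  rw [k1, Matrix.mul_assoc _ (K ^ i), ← inv_comm_pow, ← Matrix.mul_assoc,
    Matrix.mul_nonsing_inv_cancel_right _ _ d3, ← k2, hc, Matrix.mul_assoc _ V, hW' i hi]

end helpers

lemma proj_of_basis {n k ℓ : ℕ} (m : ℕ) (ξ : Fin m → ℂ) (A : Matrix (Fin n) (Fin n) ℂ)
    (B : Matrix (Fin n) (Fin ℓ) ℂ) (U : Matrix (Fin n) (Fin k) ℂ)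
    (hU : IsOrthonormalBasisOf U (ratKrylov m ξ A B)) (i : ℕ) (hi : i < m) :
    U * Uᴴ * ((aeval A (∏ i, (X - Polynomial.C (ξ i))))⁻¹ * (A ^ i * B)) =
      (aeval A (∏ i, (X - Polynomial.C (ξ i))))⁻¹ * (A ^ i * B) := by
  obtain ⟨h1, h2⟩ := hU
  have key : ∀ v ∈ ratKrylov m ξ A B, (U * Uᴴ) *ᵥ v = v := by
    intro v hv
    rw [← h2] at hv
    induction hv using Submodule.span_induction with
    | mem x hx =>
      obtain ⟨j, rfl⟩ := hx
      have : Uᵀ j = U *ᵥ Pi.single j 1 := by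
        ext a; simp [Matrix.transpose_apply]
      rw [this, Matrix.mulVec_mulVec, Matrix.mul_assoc, h1, Matrix.mul_one]
    | zero => simp
    | add x y _ _ hx hy => rw [Matrix.mulVec_add, hx, hy]
    | smul c x _ hx => rw [Matrix.mulVec_smul, hx]
  set R := (aeval A (∏ i, (X - Polynomial.C (ξ i))))⁻¹ with hR
  ext a j
  have hm : R *ᵥ ((A ^ i * B)ᵀ j) ∈ ratKrylov m ξ A B := by
    refine Submodule.mem_map.2 ⟨(A ^ i * B)ᵀ j, Submodule.subset_span ⟨i, hi, j, rfl⟩, ?_⟩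
    simp [hR, Matrix.mulVecLin_apply]
  have := congrFun (key _ hm) a
  rw [Matrix.mulVec_mulVec] at this
  rw [← Matrix.mul_assoc]
  exact this

lemma conj_aeval {n : ℕ} (m : ℕ) (ξ : Fin m → ℂ) (A : Matrix (Fin n) (Fin n) ℂ) :
    (aeval Aᴴ (∏ i, (X - Polynomial.C (starRingEnd ℂ (ξ i)))))ᴴ =
      aeval A (∏ i, (X - Polynomial.C (ξ i))) := by
  have hf : ∀ f : ℂ[X], (aeval Aᴴ (f.map (starRingEnd ℂ)))ᴴ = aeval A f := by
    intro f
    induction f using Polynomial.induction_on with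
    | C a =>
      simp [Algebra.algebraMap_eq_smul_one, Matrix.conjTranspose_smul]
    | add f g hf hg => simp only [Polynomial.map_add, map_add, Matrix.conjTranspose_add, hf, hg]
    | monomial k a h =>
      rw [pow_succ, ← mul_assoc, Polynomial.map_mul, mul_comm, map_mul, Matrix.conjTranspose_mul, h,
        map_mul]
      simp
  rw [← hf, Polynomial.map_prod]
  simp

/-- rational exactness of the rational Krylov update (Theorem 3.1 of the
paper, for the rational function `r = p/q_m`). -/
theorem stmt6 (n ℓ m kU kV : ℕ) (A : Matrix (Fin n) (Fin n) ℂ)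
    (B C : Matrix (Fin n) (Fin ℓ) ℂ) (ξ : Fin m → ℂ)
    (q : Polynomial ℂ) (hqdef : q = ∏ i, (X - Polynomial.C (ξ i)))
    (U : Matrix (Fin n) (Fin kU) ℂ) (hU : IsOrthonormalBasisOf U (ratKrylov m ξ A B))
    (V : Matrix (Fin n) (Fin kV) ℂ)
    (hV : IsOrthonormalBasisOf V (ratKrylov m (fun i => starRingEnd ℂ (ξ i)) Aᴴ C))
    (G : Matrix (Fin kU) (Fin kU) ℂ) (hG : G = Uᴴ * A * U)
    (H : Matrix (Fin kV) (Fin kV) ℂ) (hH : H = Vᴴ * Aᴴ * V)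
    (T : Matrix (Fin kU ⊕ Fin kV) (Fin kU ⊕ Fin kV) ℂ)
    (hT : T = Matrix.fromBlocks G ((Uᴴ * B) * (Vᴴ * C)ᴴ) 0 (Hᴴ + (Vᴴ * B) * (Vᴴ * C)ᴴ))
    (p : Polynomial ℂ) (hp : p.degree ≤ (m : ℕ))
    (h1 : IsUnit (aeval A q)) (h2 : IsUnit (aeval (A + B * Cᴴ) q))
    (h3 : IsUnit (aeval G q)) (h4 : IsUnit (aeval (Hᴴ + (Vᴴ * B) * (Vᴴ * C)ᴴ) q)) :
    aeval (A + B * Cᴴ) p * (aeval (A + B * Cᴴ) q)⁻¹ - aeval A p * (aeval A q)⁻¹ =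
      U * (aeval T p * (aeval T q)⁻¹).toBlocks₁₂ * Vᴴ := by
  have hq : q.degree ≤ (m : ℕ) := by
    rw [hqdef]
    refine (Polynomial.degree_prod_le _ _).trans ?_
    simp
  have hWU : ∀ i < m, U * Uᴴ * ((aeval A q)⁻¹ * (A ^ i * B)) = (aeval A q)⁻¹ * (A ^ i * B) := by
    intro i hi
    rw [hqdef]
    exact proj_of_basis m ξ A B U hU i hi
  have hWA : ∀ i < m, Cᴴ * A ^ i * (aeval A q)⁻¹ * (V * Vᴴ) = Cᴴ * A ^ i * (aeval A q)⁻¹ := by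
    intro i hi
    have := congrArg Matrix.conjTranspose (proj_of_basis m _ Aᴴ C V hV i hi)
    simp only [Matrix.conjTranspose_mul, Matrix.conjTranspose_nonsing_inv, conj_aeval,
      Matrix.conjTranspose_pow, Matrix.conjTranspose_conjTranspose] at this
    rw [hqdef]
    exact this
  obtain ⟨S, hS⟩ : ∃ S, S = A + B * Cᴴ := ⟨_, rfl⟩
  obtain ⟨K, hK⟩ : ∃ K, K = Hᴴ + (Vᴴ * B) * (Vᴴ * C)ᴴ := ⟨_, rfl⟩
  rw [← hS] at h2 ⊢
  rw [← hK] at h4 hT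
  have hKS : K = Vᴴ * S * V := by
    rw [hK, hH, hS]
    simp only [Matrix.conjTranspose_mul, Matrix.conjTranspose_conjTranspose, Matrix.mul_add,
      Matrix.add_mul, Matrix.mul_assoc]
  have d1 := (Matrix.isUnit_iff_isUnit_det _).1 h1
  have d2 := (Matrix.isUnit_iff_isUnit_det _).1 h2
  have d3 := (Matrix.isUnit_iff_isUnit_det _).1 h3
  have d4 := (Matrix.isUnit_iff_isUnit_det _).1 h4
  have hWS : ∀ i < m, Cᴴ * S ^ i * (aeval S q)⁻¹ * (V * Vᴴ) = Cᴴ * S ^ i * (aeval S q)⁻¹ := by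
    intro j hj
    let Φ : Matrix (Fin n) (Fin n) ℂ →ₗ[ℂ] Matrix (Fin ℓ) (Fin n) ℂ :=
      { toFun := fun Y => Cᴴ * (aeval S q)⁻¹ * Y * ((aeval A q)⁻¹ * (1 - V * Vᴴ))
        map_add' := fun x y => by simp only [Matrix.mul_add, Matrix.add_mul]
        map_smul' := fun c x => by simp }
    have hz : ∀ i < m, Cᴴ * A ^ i * ((aeval A q)⁻¹ * (1 - V * Vᴴ)) = 0 := by
      intro i hi
      rw [← Matrix.mul_assoc, Matrix.mul_sub, hWA i hi, Matrix.mul_one, sub_self]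
    have h := phi_bez m S (A - S) A S (A - S) A Φ 0 (by
      intro i hi k hk
      have e : A - S = -(B * Cᴴ) := by rw [hS]; abel
      have e2 : Φ (S ^ i * (A - S) * A ^ k) = -(Cᴴ * (aeval S q)⁻¹ * S ^ i * B *
          (Cᴴ * A ^ k * ((aeval A q)⁻¹ * (1 - V * Vᴴ)))) := by
        simp only [Φ, LinearMap.coe_mk, AddHom.coe_mk, e, Matrix.mul_neg, Matrix.neg_mul,
          Matrix.mul_assoc]
      rw [e2, hz k hk]; simp) q (X ^ j) hq (by rw [degree_X_pow]; exact_mod_cast hj.le)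
    have hb : bez S (A - S) A q (X ^ j) = aeval S q * A ^ j - S ^ j * aeval A q := by
      simp only [bez, tau_sub, map_pow, aeval_X, mul_sub]
      have : aeval S q * S ^ j = S ^ j * aeval S q := by
        have : aeval S (q * X ^ j) = aeval S (X ^ j * q) := by rw [mul_comm]
        simpa using this
      rw [this]; abel
    rw [hb, LinearMap.zero_apply] at h
    have e3 : Φ (aeval S q * A ^ j - S ^ j * aeval A q) =
        Cᴴ * A ^ j * ((aeval A q)⁻¹ * (1 - V * Vᴴ)) -
          Cᴴ * S ^ j * (aeval S q)⁻¹ * (1 - V * Vᴴ) := by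
      simp only [Φ, LinearMap.coe_mk, AddHom.coe_mk]
      rw [Matrix.mul_sub, Matrix.sub_mul]
      congr 1
      · rw [← Matrix.mul_assoc (Cᴴ * _), Matrix.nonsing_inv_mul_cancel_right _ _ d2]
      · rw [← Matrix.mul_assoc, ← Matrix.mul_assoc, Matrix.mul_nonsing_inv_cancel_right _ _ d1,
          Matrix.mul_assoc Cᴴ, inv_comm_pow, ← Matrix.mul_assoc]
    rw [e3, hz j hj, zero_sub, neg_eq_zero, Matrix.mul_sub, Matrix.mul_one, sub_eq_zero] at h
    exact h.symm
  have eL := exact_left m A B U G hG q hq h1 h3 hWU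
  have eR := exact_right m S Cᴴ V K hKS q hq h2 h4 hWS
  obtain ⟨N, hN⟩ : ∃ N, N = (Uᴴ * B) * (Vᴴ * C)ᴴ := ⟨_, rfl⟩
  rw [← hN] at hT
  let Φ : Matrix (Fin n) (Fin n) ℂ →ₗ[ℂ] Matrix (Fin n) (Fin n) ℂ :=
    { toFun := fun Y => (aeval A q)⁻¹ * Y * (aeval S q)⁻¹
      map_add' := fun x y => by simp only [Matrix.mul_add, Matrix.add_mul]
      map_smul' := fun c x => by simp }
  let Ψ : Matrix (Fin kU) (Fin kV) ℂ →ₗ[ℂ] Matrix (Fin n) (Fin n) ℂ :=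
    { toFun := fun Y => U * ((aeval G q)⁻¹ * Y * (aeval K q)⁻¹) * Vᴴ
      map_add' := fun x y => by simp only [Matrix.mul_add, Matrix.add_mul]
      map_smul' := fun c x => by simp }
  have hfin := phi_bez m A (S - A) S G N K Φ Ψ (by
    intro i hi j hj
    have e : S - A = B * Cᴴ := by rw [hS]; abel
    have e1 : Φ (A ^ i * (S - A) * S ^ j) =
        ((aeval A q)⁻¹ * (A ^ i * B)) * (Cᴴ * S ^ j * (aeval S q)⁻¹) := by
      simp only [Φ, LinearMap.coe_mk, AddHom.coe_mk, e, Matrix.mul_assoc]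
    rw [e1, eL i hi, eR j hj]
    simp only [Ψ, LinearMap.coe_mk, AddHom.coe_mk, hN, Matrix.mul_assoc,
      Matrix.conjTranspose_mul, Matrix.conjTranspose_conjTranspose]) q p hq hp
  have hl : Φ (bez A (S - A) S q p) =
      aeval S p * (aeval S q)⁻¹ - aeval A p * (aeval A q)⁻¹ := by
    have hb : bez A (S - A) S q p = aeval A q * aeval S p - aeval A p * aeval S q := by
      simp only [bez, tau_sub, mul_sub]
      have : aeval A q * aeval A p = aeval A p * aeval A q := by
        rw [← map_mul, ← map_mul, mul_comm]
      rw [this]; abel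
    simp only [Φ, LinearMap.coe_mk, AddHom.coe_mk]
    rw [hb, Matrix.mul_sub, Matrix.sub_mul, Matrix.nonsing_inv_mul_cancel_left _ _ d1,
      ← Matrix.mul_assoc, Matrix.mul_nonsing_inv_cancel_right _ _ d2, inv_comm_aeval]
  rw [← hl, hfin]
  have hX : (aeval T p * (aeval T q)⁻¹).toBlocks₁₂ =
      (aeval G q)⁻¹ * bez G N K q p * (aeval K q)⁻¹ := by
    rw [hT, aeval_blocks, aeval_blocks,
      Matrix.inv_fromBlocks_zero₂₁_of_isUnit_iff _ _ _ ⟨fun _ => h4, fun _ => h3⟩,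
      Matrix.fromBlocks_multiply, Matrix.toBlocks_fromBlocks₁₂, bez, Matrix.mul_sub,
      Matrix.nonsing_inv_mul_cancel_left _ _ d3, Matrix.sub_mul, ← Matrix.mul_assoc (aeval G q)⁻¹,
      inv_comm_aeval, Matrix.mul_neg]
    simp only [Matrix.mul_assoc]
    abel
  rw [hX]
  rfl
end

section
/- Let A ∈ ℂ^{n×n}, B, C ∈ ℂ^{n×ℓ}. Let U be an orthonormal basis of the block Krylov subspace K_m(A,B) and V be an orthonormal basis of K_m(A*,C). Set G = U*AU, H = V*A*V, and T = [[G, (U*B)(V*C)*], [0, H* + (V*B)(V*C)*]]. Then for every polynomial p of degree at most m: p(A+BC*) − p(A) = U X V*, where X is the (1,2) block of p(T). -/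
open Polynomial Matrix

theorem proj_vec {n k : ℕ} (U : Matrix (Fin n) (Fin k) ℂ) (S : Submodule ℂ (Fin n → ℂ))
    (hU : IsOrthonormalBasisOf U S) (v : Fin n → ℂ) (hv : v ∈ S) : (U * Uᴴ) *ᵥ v = v := by
  obtain ⟨h1, h2⟩ := hU
  rw [← h2] at hv
  induction hv using Submodule.span_induction with
  | mem x hx =>
    obtain ⟨j, rfl⟩ := hx
    have h : U * Uᴴ * U = U := by rw [Matrix.mul_assoc, h1, Matrix.mul_one]
    ext i
    exact congrFun (congrFun h i) j
  | zero => simp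
  | add x y _ _ hx hy => rw [Matrix.mulVec_add, hx, hy]
  | smul a x _ hx => rw [Matrix.mulVec_smul, hx]

theorem proj_krylov {n k l m : ℕ} (A : Matrix (Fin n) (Fin n) ℂ) (B : Matrix (Fin n) (Fin l) ℂ)
    (U : Matrix (Fin n) (Fin k) ℂ) (hU : IsOrthonormalBasisOf U (Krylov m A B))
    (i : ℕ) (hi : i < m) : U * Uᴴ * (A ^ i * B) = A ^ i * B := by
  ext a j
  have := proj_vec U _ hU ((A ^ i * B)ᵀ j) (Submodule.subset_span ⟨i, hi, j, rfl⟩)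
  exact congrFun this a

theorem proj_krylov_pert {n l m : ℕ} (A P : Matrix (Fin n) (Fin n) ℂ)
    (C : Matrix (Fin n) (Fin l) ℂ) (R : Matrix (Fin l) (Fin n) ℂ)
    (hP : ∀ i < m, P * (A ^ i * C) = A ^ i * C) (s : ℕ) :
    ∀ i, i + s < m → P * (A ^ i * ((A + C * R) ^ s * C)) = A ^ i * ((A + C * R) ^ s * C) := by
  induction s with
  | zero => intro i hi; simpa using hP i hi
  | succ s ih =>
    intro i hi
    have e : A ^ i * ((A + C * R) ^ (s + 1) * C) =
        A ^ (i + 1) * ((A + C * R) ^ s * C) + A ^ i * C * (R * ((A + C * R) ^ s * C)) := by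
      rw [pow_succ' (A + C * R), pow_succ A]
      simp only [Matrix.add_mul, Matrix.mul_add, Matrix.mul_assoc]
    rw [e, Matrix.mul_add, ih (i + 1) (by omega), ← Matrix.mul_assoc P (A ^ i * C),
      hP i (by omega)]

theorem diff_succ {n l : ℕ} (A : Matrix (Fin n) (Fin n) ℂ)
    (B : Matrix (Fin n) (Fin l) ℂ) (R : Matrix (Fin l) (Fin n) ℂ) (k : ℕ) :
    (A + B * R) ^ (k + 1) - A ^ (k + 1) =
      A * ((A + B * R) ^ k - A ^ k) + B * (R * (A + B * R) ^ k) := by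
  rw [pow_succ' (A + B * R), pow_succ' A]
  simp only [Matrix.add_mul, Matrix.mul_sub, Matrix.mul_assoc]
  abel

theorem proj_diff {n l m : ℕ} (A P : Matrix (Fin n) (Fin n) ℂ)
    (B : Matrix (Fin n) (Fin l) ℂ) (R : Matrix (Fin l) (Fin n) ℂ)
    (hP : ∀ i < m, P * (A ^ i * B) = A ^ i * B) (k : ℕ) :
    ∀ i, i + k ≤ m → P * (A ^ i * ((A + B * R) ^ k - A ^ k)) =
      A ^ i * ((A + B * R) ^ k - A ^ k) := by
  induction k with
  | zero => intro i hi; simp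
  | succ k ih =>
    intro i hi
    have e : A ^ i * ((A + B * R) ^ (k + 1) - A ^ (k + 1)) =
        A ^ (i + 1) * ((A + B * R) ^ k - A ^ k) + A ^ i * B * (R * (A + B * R) ^ k) := by
      rw [diff_succ, pow_succ A i]
      simp only [Matrix.mul_add, Matrix.mul_assoc]
    rw [e, Matrix.mul_add, ih (i + 1) (by omega), ← Matrix.mul_assoc P (A ^ i * B),
      hP i (by omega)]

theorem block_pow {a b : ℕ} (G : Matrix (Fin a) (Fin a) ℂ) (W : Matrix (Fin a) (Fin b) ℂ)
    (K : Matrix (Fin b) (Fin b) ℂ) (k : ℕ) :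
    (fromBlocks G W 0 K) ^ k = fromBlocks (G ^ k) ((fromBlocks G W 0 K) ^ k).toBlocks₁₂ 0 (K ^ k) := by
  induction k with
  | zero => ext (i | i) (j | j) <;> simp [toBlocks₁₂, Matrix.one_apply]
  | succ k ih =>
    rw [pow_succ' (fromBlocks G W 0 K), ih]
    simp [fromBlocks_multiply, pow_succ']

theorem block_pow_succ {a b : ℕ} (G : Matrix (Fin a) (Fin a) ℂ) (W : Matrix (Fin a) (Fin b) ℂ)
    (K : Matrix (Fin b) (Fin b) ℂ) (k : ℕ) :
    ((fromBlocks G W 0 K) ^ (k + 1)).toBlocks₁₂ =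
      G * ((fromBlocks G W 0 K) ^ k).toBlocks₁₂ + W * K ^ k := by
  rw [pow_succ', block_pow G W K k, fromBlocks_multiply]
  simp

/-- polynomial exactness of the Krylov update: if `U`, `V` are orthonormal
bases of `K_m(A,B)` and `K_m(Aᴴ,C)`, `G = Uᴴ A U`, `H = Vᴴ Aᴴ V`, and
`T = [[G, (Uᴴ B)(Vᴴ C)ᴴ], [0, Hᴴ + (Vᴴ B)(Vᴴ C)ᴴ]]`, then for every polynomial `p` of
degree at most `m`: `p(A + B Cᴴ) - p(A) = U X Vᴴ` with `X` the (1,2) block of `p(T)`. -/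
theorem stmt7 (n ℓ m kU kV : ℕ) (A : Matrix (Fin n) (Fin n) ℂ)
    (B C : Matrix (Fin n) (Fin ℓ) ℂ)
    (U : Matrix (Fin n) (Fin kU) ℂ) (hU : IsOrthonormalBasisOf U (Krylov m A B))
    (V : Matrix (Fin n) (Fin kV) ℂ) (hV : IsOrthonormalBasisOf V (Krylov m Aᴴ C))
    (G : Matrix (Fin kU) (Fin kU) ℂ) (hG : G = Uᴴ * A * U)
    (H : Matrix (Fin kV) (Fin kV) ℂ) (hH : H = Vᴴ * Aᴴ * V)
    (T : Matrix (Fin kU ⊕ Fin kV) (Fin kU ⊕ Fin kV) ℂ)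
    (hT : T = Matrix.fromBlocks G ((Uᴴ * B) * (Vᴴ * C)ᴴ) 0 (Hᴴ + (Vᴴ * B) * (Vᴴ * C)ᴴ)) :
    ∀ p : Polynomial ℂ, p.degree ≤ (m : ℕ) →
      aeval (A + B * Cᴴ) p - aeval A p = U * (aeval T p).toBlocks₁₂ * Vᴴ := by
  have hPU := proj_krylov A B U hU
  have hPV := proj_krylov_pert Aᴴ (V * Vᴴ) C Bᴴ (proj_krylov Aᴴ C V hV)
  have hK : Hᴴ + (Vᴴ * B) * (Vᴴ * C)ᴴ = Vᴴ * (A + B * Cᴴ) * V := by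
    subst hH
    simp only [conjTranspose_mul, conjTranspose_conjTranspose, Matrix.mul_add, Matrix.add_mul,
      Matrix.mul_assoc]
  have hrow : ∀ s < m, Cᴴ * (A + B * Cᴴ) ^ s * (V * Vᴴ) = Cᴴ * (A + B * Cᴴ) ^ s := by
    intro s hs
    have h := congrArg conjTranspose (hPV s 0 (by omega))
    simpa [conjTranspose_mul, conjTranspose_pow, conjTranspose_add] using h
  have hKs : ∀ s < m, Cᴴ * V * (Vᴴ * (A + B * Cᴴ) * V) ^ s * Vᴴ = Cᴴ * (A + B * Cᴴ) ^ s := by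
    intro s
    induction s with
    | zero => intro hs; simpa [Matrix.mul_assoc] using hrow 0 hs
    | succ s ih =>
      intro hs
      have e : Cᴴ * V * (Vᴴ * (A + B * Cᴴ) * V) ^ (s + 1) * Vᴴ =
          (Cᴴ * V * (Vᴴ * (A + B * Cᴴ) * V) ^ s * Vᴴ) * (A + B * Cᴴ) * (V * Vᴴ) := by
        rw [pow_succ]; simp only [Matrix.mul_assoc]
      rw [e, ih (by omega), Matrix.mul_assoc Cᴴ, ← pow_succ, hrow _ hs]
  have key : ∀ k ≤ m, (A + B * Cᴴ) ^ k - A ^ k = U * (T ^ k).toBlocks₁₂ * Vᴴ := by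
    intro k
    induction k with
    | zero =>
      intro _
      have : (1 : Matrix (Fin kU ⊕ Fin kV) (Fin kU ⊕ Fin kV) ℂ).toBlocks₁₂ = 0 := by
        ext i j; simp [toBlocks₁₂]
      simp [this]
    | succ k ih =>
      intro hk
      have h0 := hPU 0 (by omega)
      have h1 := proj_diff A (U * Uᴴ) B Cᴴ hPU k 1 (by omega)
      rw [pow_zero, Matrix.one_mul] at h0
      rw [pow_one] at h1
      have e : U * (T ^ (k + 1)).toBlocks₁₂ * Vᴴ =
          U * Uᴴ * (A * (U * (T ^ k).toBlocks₁₂ * Vᴴ)) +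
          U * Uᴴ * B * (Cᴴ * V * (Vᴴ * (A + B * Cᴴ) * V) ^ k * Vᴴ) := by
        rw [hT, block_pow_succ, hK, hG]
        simp only [conjTranspose_mul, conjTranspose_conjTranspose, Matrix.mul_add,
          Matrix.add_mul, Matrix.mul_assoc]
      rw [e, ← ih (by omega), h1, h0, hKs k (by omega), diff_succ]
  intro p hp
  have hd : p.natDegree < m + 1 := Nat.lt_succ_of_le (natDegree_le_of_degree_le hp)
  have hsum : (∑ i ∈ Finset.range (m + 1), p.coeff i • T ^ i).toBlocks₁₂ =
      ∑ i ∈ Finset.range (m + 1), p.coeff i • (T ^ i).toBlocks₁₂ := by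
    ext i j
    simp [toBlocks₁₂, Matrix.sum_apply]
  rw [aeval_eq_sum_range' hd, aeval_eq_sum_range' hd, aeval_eq_sum_range' hd, hsum,
    ← Finset.sum_sub_distrib, Matrix.mul_sum, Matrix.sum_mul]
  refine Finset.sum_congr rfl fun i hi => ?_
  rw [← smul_sub, key i (by simpa [Nat.lt_succ_iff] using hi), Matrix.mul_smul, Matrix.smul_mul]
end

section
/- Let r(z) = p(z)/q(z) with p(z) = Σ_{i=0}^{m_p} α_i z^i, q(z) = Σ_{i=0}^{m_q} β_i z^i, and set m = max{m_p, m_q}. Let H(α) ∈ ℂ^{m×m} be the Hankel matrix with entries H(α)_{ij} = α_{i+j−1} if i+j−1 ≤ m_p and 0 otherwise (indices 1 ≤ i,j ≤ m), and define H(β) analogously from the β_i. Let A ∈ ℂ^{n×n} and b, c ∈ ℂ^n be such that q(A) and q(A+bc*) are invertible, and define K_m = [b, Ab, …, A^{m−1}b] ∈ ℂ^{n×m}, L_m = [c, (A*+cb*)c, …, (A*+cb*)^{m−1}c] ∈ ℂ^{n×m}, Y_α = L_m H(α)*, Y_β = L_m H(β)*, X = q(A)^{−1}K_m, and M = I_m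 + Y_β* X. If M is invertible, then with Y* := Y_α* − M^{−1} Y_β* (r(A) + X Y_α*) one has r(A+bc*) − r(A) = X Y*. -/
open Polynomial Matrix

/-- The `m × m` Hankel matrix built from coefficients `α_1, …, α_{mp}`
(1-indexed: `H(α)_{ij} = α_{i+j-1}` if `i+j-1 ≤ mp`, else `0`). -/
noncomputable def hankelOf (m : ℕ) (α : ℕ → ℂ) (mp : ℕ) : Matrix (Fin m) (Fin m) ℂ :=
  Matrix.of fun i j => if (i : ℕ) + (j : ℕ) + 1 ≤ mp then α ((i : ℕ) + (j : ℕ) + 1) else 0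

/-- The Krylov matrix `[b, Ab, …, A^(m-1)b]`. -/
noncomputable def krylovMat {n : ℕ} (m : ℕ) (A : Matrix (Fin n) (Fin n) ℂ) (b : Fin n → ℂ) :
    Matrix (Fin n) (Fin m) ℂ :=
  Matrix.of fun i j => (A ^ (j : ℕ)).mulVec b i

/-- The telescoping expansion of `B^(N+1) - A^(N+1)`. -/
lemma pow_sub_pow_aux {n : ℕ} (A D : Matrix (Fin n) (Fin n) ℂ) (N : ℕ) :
    (A + D) ^ (N + 1) = A ^ (N + 1) +
      ∑ j ∈ Finset.range (N + 1), A ^ j * D * (A + D) ^ (N - j) := by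
  induction N with
  | zero => simp
  | succ N ih =>
    rw [Finset.sum_range_succ, pow_succ (A + D) (N + 1)]
    have h : ∑ j ∈ Finset.range (N + 1), A ^ j * D * (A + D) ^ (N + 1 - j)
        = (∑ j ∈ Finset.range (N + 1), A ^ j * D * (A + D) ^ (N - j)) * (A + D) := by
      rw [Finset.sum_mul]
      refine Finset.sum_congr rfl fun j hj => ?_
      have hj' : j < N + 1 := Finset.mem_range.1 hj
      have : N + 1 - j = (N - j) + 1 := by omega
      rw [this, pow_succ]
      simp only [mul_assoc]
    rw [h]
    nth_rewrite 1 [ih]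
    rw [add_mul]
    simp only [Nat.sub_self, pow_zero, mul_one, mul_add, pow_succ]
    abel

lemma double_sum_aux {n : ℕ} (A D : Matrix (Fin n) (Fin n) ℂ) (α : ℕ → ℂ) (m mp : ℕ)
    (h : mp ≤ m) :
    ∑ i ∈ Finset.range (mp + 1), α i • (A + D) ^ i
      = ∑ i ∈ Finset.range (mp + 1), α i • A ^ i +
        ∑ j ∈ Finset.range m, ∑ k ∈ Finset.range m,
          (if j + k + 1 ≤ mp then α (j + k + 1) else 0) • (A ^ j * D * (A + D) ^ k) := by
  induction mp with
  | zero => simp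
  | succ N ih =>
    rw [Finset.sum_range_succ, ih (by omega), Finset.sum_range_succ _ (N + 1),
      pow_sub_pow_aux A D N]
    have key : ∑ j ∈ Finset.range m, ∑ k ∈ Finset.range m,
          (if j + k + 1 ≤ N + 1 then α (j + k + 1) else 0) • (A ^ j * D * (A + D) ^ k)
        = ∑ j ∈ Finset.range m, ∑ k ∈ Finset.range m,
          (if j + k + 1 ≤ N then α (j + k + 1) else 0) • (A ^ j * D * (A + D) ^ k)
        + ∑ j ∈ Finset.range (N + 1), α (N + 1) • (A ^ j * D * (A + D) ^ (N - j)) := by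
      have e : ∑ j ∈ Finset.range (N + 1), α (N + 1) • (A ^ j * D * (A + D) ^ (N - j))
          = ∑ j ∈ Finset.range m, ∑ k ∈ Finset.range m,
            (if j + k = N then α (N + 1) else 0) • (A ^ j * D * (A + D) ^ k) := by
        have hs : Finset.range (N + 1) ⊆ Finset.range m := by
          intro x hx
          simp only [Finset.mem_range] at *
          omega
        rw [← Finset.sum_subset hs]
        · refine Finset.sum_congr rfl fun j hj => ?_
          have hj' := Finset.mem_range.1 hj
          rw [Finset.sum_eq_single (N - j)]
          · rw [if_pos (by omega)]
          · intro k _ hk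
            rw [if_neg (by omega), zero_smul]
          · intro hk
            exact absurd (Finset.mem_range.2 (by omega)) hk
        · intro j _ hj
          have hj' : ¬ j < N + 1 := fun h => hj (Finset.mem_range.2 h)
          refine Finset.sum_eq_zero fun k _ => ?_
          rw [if_neg (by omega), zero_smul]
      rw [e, ← Finset.sum_add_distrib]
      refine Finset.sum_congr rfl fun j _ => ?_
      rw [← Finset.sum_add_distrib]
      refine Finset.sum_congr rfl fun k _ => ?_
      rw [← add_smul]
      congr 1
      by_cases h1 : j + k = N
      · subst h1; simp
      · by_cases h2 : j + k + 1 ≤ N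
        · rw [if_pos (by omega), if_pos h2, if_neg h1, add_zero]
        · rw [if_neg (by omega), if_neg h2, if_neg h1, add_zero]
    rw [key, smul_add, Finset.smul_sum]
    abel

lemma krylov_prod_aux {n : ℕ} (m : ℕ) (A : Matrix (Fin n) (Fin n) ℂ) (b c : Fin n → ℂ)
    (H : Matrix (Fin m) (Fin m) ℂ) :
    krylovMat m A b * (H * (krylovMat m (Aᴴ + vecMulVec c (star b)) c)ᴴ)
      = ∑ j : Fin m, ∑ k : Fin m, H j k •
        (A ^ (j : ℕ) * vecMulVec b (star c) * (A + vecMulVec b (star c)) ^ (k : ℕ)) := by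
  have hB : Aᴴ + vecMulVec c (star b) = (A + vecMulVec b (star c))ᴴ := by
    rw [conjTranspose_add, conjTranspose_vecMulVec, star_star]
  rw [hB]
  generalize A + vecMulVec b (star c) = B
  ext x y
  simp only [Matrix.sum_apply, Matrix.smul_apply, mul_vecMulVec, vecMulVec_mul]
  simp only [Matrix.mul_apply, Finset.mul_sum]
  refine Finset.sum_congr rfl fun j _ => Finset.sum_congr rfl fun k _ => ?_
  have : star (((Bᴴ) ^ (k : ℕ)) *ᵥ c) = star c ᵥ* B ^ (k : ℕ) := by
    rw [← conjTranspose_pow, star_mulVec, conjTranspose_conjTranspose]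
  have h2 := congrFun this y
  simp only [Pi.star_apply] at h2
  simp only [krylovMat, conjTranspose_apply, of_apply, vecMulVec_apply, smul_eq_mul, h2]
  ring

lemma aeval_update_aux {n : ℕ} (m mp : ℕ) (h : mp ≤ m) (α : ℕ → ℂ)
    (A : Matrix (Fin n) (Fin n) ℂ) (b c : Fin n → ℂ) (p : Polynomial ℂ)
    (hp : p = ∑ i ∈ Finset.range (mp + 1), Polynomial.C (α i) * X ^ i) :
    aeval (A + vecMulVec b (star c)) p = aeval A p + krylovMat m A b *
      (hankelOf m α mp * (krylovMat m (Aᴴ + vecMulVec c (star b)) c)ᴴ) := by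
  have hev : ∀ B : Matrix (Fin n) (Fin n) ℂ,
      aeval B p = ∑ i ∈ Finset.range (mp + 1), α i • B ^ i := by
    intro B
    rw [hp, map_sum]
    refine Finset.sum_congr rfl fun i _ => ?_
    rw [map_mul, aeval_C, map_pow, aeval_X, Algebra.smul_def]
  rw [hev, hev, double_sum_aux A _ α m mp h, krylov_prod_aux, Finset.sum_range]
  congr 1
  rw [Finset.sum_range]
  refine Finset.sum_congr rfl fun j _ => ?_
  rw [Finset.sum_range]
  rfl

/-- the Bernstein–Van Loan generalized Sherman–Morrison formula for a
rational function `r = p/q` (with `p(z) = Σ_{i=0}^{mp} α_i z^i`,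
`q(z) = Σ_{i=0}^{mq} β_i z^i`) and a rank-one update `b cᴴ`. -/
theorem stmt8 (n mp mq : ℕ) (α β : ℕ → ℂ) (p q : Polynomial ℂ)
    (hpdef : p = ∑ i ∈ Finset.range (mp + 1), Polynomial.C (α i) * X ^ i)
    (hqdef : q = ∑ i ∈ Finset.range (mq + 1), Polynomial.C (β i) * X ^ i)
    (m : ℕ) (hm : m = max mp mq)
    (A : Matrix (Fin n) (Fin n) ℂ) (b c : Fin n → ℂ)
    (hqA : IsUnit (aeval A q))
    (hqAbc : IsUnit (aeval (A + Matrix.vecMulVec b (star c)) q))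
    (K L : Matrix (Fin n) (Fin m) ℂ)
    (hK : K = krylovMat m A b)
    (hL : L = krylovMat m (Aᴴ + Matrix.vecMulVec c (star b)) c)
    (Yα Yβ Xm : Matrix (Fin n) (Fin m) ℂ)
    (hYα : Yα = L * (hankelOf m α mp)ᴴ)
    (hYβ : Yβ = L * (hankelOf m β mq)ᴴ)
    (hX : Xm = (aeval A q)⁻¹ * K)
    (M : Matrix (Fin m) (Fin m) ℂ) (hM : M = 1 + Yβᴴ * Xm) (hMunit : IsUnit M)
    (Ys : Matrix (Fin m) (Fin n) ℂ)
    (hYs : Ys = Yαᴴ - M⁻¹ * Yβᴴ * (aeval A p * (aeval A q)⁻¹ + Xm * Yαᴴ)) :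
    aeval (A + Matrix.vecMulVec b (star c)) p *
        (aeval (A + Matrix.vecMulVec b (star c)) q)⁻¹ -
      aeval A p * (aeval A q)⁻¹ = Xm * Ys := by
  have hp := aeval_update_aux m mp (hm ▸ le_max_left _ _) α A b c p hpdef
  have hq := aeval_update_aux m mq (hm ▸ le_max_right _ _) β A b c q hqdef
  have ha : Yαᴴ = hankelOf m α mp * Lᴴ := by
    rw [hYα, conjTranspose_mul, conjTranspose_conjTranspose]
  have hb : Yβᴴ = hankelOf m β mq * Lᴴ := by
    rw [hYβ, conjTranspose_mul, conjTranspose_conjTranspose]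
  rw [← hL, ← hK, ← ha] at hp
  rw [← hL, ← hK, ← hb] at hq
  have hcomm : Commute (aeval (A + vecMulVec b (star c)) p)
      (aeval (A + vecMulVec b (star c)) q) := by
    unfold Commute SemiconjBy
    rw [← map_mul, ← map_mul, mul_comm]
  have hcommA : Commute (aeval A p) (aeval A q) := by
    unfold Commute SemiconjBy
    rw [← map_mul, ← map_mul, mul_comm]
  generalize aeval (A + vecMulVec b (star c)) p = PB at *
  generalize aeval (A + vecMulVec b (star c)) q = QB at *
  generalize aeval A p = P at *
  generalize aeval A q = Q at *
  generalize Yαᴴ = Ya at *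
  generalize Yβᴴ = Yb at *
  have dQ := (Matrix.isUnit_iff_isUnit_det _).1 hqA
  have dQB := (Matrix.isUnit_iff_isUnit_det _).1 hqAbc
  have dM := (Matrix.isUnit_iff_isUnit_det _).1 hMunit
  have hQX : Q * Xm = K := by rw [hX, Matrix.mul_nonsing_inv_cancel_left _ _ dQ]
  have hQP : Q * (P * Q⁻¹) = P := by
    rw [← mul_assoc, ← hcommA.eq, Matrix.mul_nonsing_inv_cancel_right _ _ dQ]
  have hYX : Yb * Xm = M - 1 := by rw [hM]; abel
  set S := P * Q⁻¹ + Xm * Ya with hS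
  have hQS : Q * S = PB := by
    rw [hS, mul_add, hQP, ← Matrix.mul_assoc, hQX, hp]
  have hR : P * Q⁻¹ + Xm * Ys = S - Xm * (M⁻¹ * (Yb * S)) := by
    rw [hYs, Matrix.mul_sub, hS]
    simp only [Matrix.mul_assoc]
    abel
  have hQBR : QB * (P * Q⁻¹ + Xm * Ys) = PB := by
    have h1 : Yb * (Xm * (M⁻¹ * (Yb * S))) = Yb * S - M⁻¹ * (Yb * S) := by
      rw [← Matrix.mul_assoc, hYX, Matrix.sub_mul, Matrix.one_mul,
        Matrix.mul_nonsing_inv_cancel_left _ _ dM]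
    rw [hR, hq, Matrix.add_mul, Matrix.mul_sub, Matrix.mul_assoc K, Matrix.mul_sub Yb, h1, hQS,
      ← Matrix.mul_assoc Q, hQX, sub_sub_cancel]
    abel
  have hfin : PB * QB⁻¹ = P * Q⁻¹ + Xm * Ys := by
    have h1 : QB * (PB * QB⁻¹) = PB := by
      rw [← mul_assoc, ← hcomm.eq, Matrix.mul_nonsing_inv_cancel_right _ _ dQB]
    exact hqAbc.mul_left_cancel (h1.trans hQBR.symm)
  rw [hfin]
  abel
end

section
/- Let B_{11} ∈ ℂ^{k×k}, B_{22} ∈ ℂ^{l×l}, B_{12} ∈ ℂ^{k×l}, and set 𝓑 = [[B_{11}, B_{12}], [0, B_{22}]]. Let E ⊆ ℂ be a compact convex set containing the numerical ranges W(B_{11}) and W(B_{22}). Then for every polynomial p (whose derivative is p′): ‖[p(𝓑)]_{1,2}‖_F ≤ (1+√2)² · (sup_{z∈E} |p′(z)|) · ‖B_{12}‖_F, where [p(𝓑)]_{1,2} denotes the (1,2) block (of size k×l) of p(𝓑). -/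
open Polynomial Matrix

/-- The numerical range `W(A) = { xᴴ A x : ‖x‖₂ = 1 }` of a square complex matrix. -/
def numRange {k : ℕ} (A : Matrix (Fin k) (Fin k) ℂ) : Set ℂ :=
  {z | ∃ x : Fin k → ℂ, star x ⬝ᵥ x = 1 ∧ z = star x ⬝ᵥ A.mulVec x}

/-- The Frobenius norm of a matrix. -/
noncomputable def frobNorm {k l : ℕ} (M : Matrix (Fin k) (Fin l) ℂ) : ℝ :=
  Real.sqrt (∑ i, ∑ j, ‖M i j‖ ^ 2)


/-! ### Part 1: a smooth convex curve around a compact convex set -/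

/-- `Re (exp (-iθ) z)`. -/
noncomputable def dirRe (θ : ℝ) (z : ℂ) : ℝ := Real.cos θ * z.re + Real.sin θ * z.im

/-- A positively oriented convex curve around the origin, parametrised by its normal angle. -/
structure CurveData where
  σ : ℝ → ℂ
  ρ : ℝ → ℝ
  δ : ℝ
  hδ : 0 < δ
  hρc : Continuous ρ
  hρ : ∀ θ, 0 ≤ ρ θ
  hd : ∀ θ : ℝ, HasDerivAt σ ((ρ θ : ℂ) * (Complex.I * Complex.exp (θ * Complex.I))) θ
  per : σ (2 * Real.pi) = σ 0
  h0 : ∀ θ, δ ≤ dirRe θ (σ θ)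

/-- Support function. -/
noncomputable def suppFun (F : Set ℂ) (θ : ℝ) : ℝ := sSup ((fun z => dirRe θ z) '' F)

lemma dirRe_le_norm (θ : ℝ) (z : ℂ) : |dirRe θ z| ≤ ‖z‖ := by
  have h1 : dirRe θ z ^ 2 ≤ ‖z‖ ^ 2 := by
    rw [Complex.sq_norm, Complex.normSq_apply, dirRe]
    nlinarith [Real.sin_sq_add_cos_sq θ, sq_nonneg (Real.cos θ * z.im - Real.sin θ * z.re)]
  exact abs_le_of_sq_le_sq h1 (norm_nonneg _)

lemma dirRe_lip (θ φ : ℝ) (z : ℂ) : |dirRe θ z - dirRe φ z| ≤ ‖z‖ * |θ - φ| := by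
  have e1 : dirRe θ z = (z * Complex.exp (-(θ:ℂ) * Complex.I)).re := by
    have : (-(θ:ℂ)) = ((-θ : ℝ) : ℂ) := by push_cast; ring
    rw [this, Complex.mul_re, Complex.exp_ofReal_mul_I_re, Complex.exp_ofReal_mul_I_im, dirRe]
    simp; ring
  have e2 : dirRe φ z = (z * Complex.exp (-(φ:ℂ) * Complex.I)).re := by
    have : (-(φ:ℂ)) = ((-φ : ℝ) : ℂ) := by push_cast; ring
    rw [this, Complex.mul_re, Complex.exp_ofReal_mul_I_re, Complex.exp_ofReal_mul_I_im, dirRe]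
    simp; ring
  rw [e1, e2, ← Complex.sub_re, ← mul_sub]
  refine (Complex.abs_re_le_norm _).trans ?_
  rw [norm_mul]
  gcongr
  have h3 : Complex.exp (-(θ:ℂ) * Complex.I) - Complex.exp (-(φ:ℂ) * Complex.I)
      = Complex.exp (-(φ:ℂ) * Complex.I) * (Complex.exp (Complex.I * ((φ - θ : ℝ) : ℂ)) - 1) := by
    rw [mul_sub, ← Complex.exp_add]
    push_cast
    ring_nf
  have : (-(φ:ℂ)) = ((-φ : ℝ) : ℂ) := by push_cast; ring
  rw [h3, norm_mul, this, Complex.norm_exp_ofReal_mul_I, one_mul]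
  refine (Real.norm_exp_I_mul_ofReal_sub_one_le).trans ?_
  rw [Real.norm_eq_abs, abs_sub_comm]

section supp
variable {F : Set ℂ} {R : ℝ}
lemma supp_bdd (hR : ∀ z ∈ F, ‖z‖ ≤ R) (θ : ℝ) : BddAbove ((fun z => dirRe θ z) '' F) := by
  refine ⟨R, ?_⟩
  rintro _ ⟨z, hz, rfl⟩
  exact (le_abs_self _).trans ((dirRe_le_norm θ z).trans (hR z hz))

lemma le_supp (hR : ∀ z ∈ F, ‖z‖ ≤ R) (θ : ℝ) {z : ℂ} (hz : z ∈ F) : dirRe θ z ≤ suppFun F θ :=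
  le_csSup (supp_bdd hR θ) ⟨z, hz, rfl⟩

lemma supp_le (hne : F.Nonempty) (θ : ℝ) {c : ℝ} (h : ∀ z ∈ F, dirRe θ z ≤ c) : suppFun F θ ≤ c := by
  refine csSup_le (hne.image _) ?_
  rintro _ ⟨z, hz, rfl⟩
  exact h z hz

lemma supp_nonneg (hR : ∀ z ∈ F, ‖z‖ ≤ R) (h0 : (0:ℂ) ∈ F) (θ : ℝ) : 0 ≤ suppFun F θ := by
  have := le_supp hR θ h0
  simpa [dirRe] using this

lemma supp_lip (hR : ∀ z ∈ F, ‖z‖ ≤ R) (h0 : (0:ℂ) ∈ F) (θ φ : ℝ) : |suppFun F θ - suppFun F φ| ≤ R * |θ - φ| := by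
  have key : ∀ a b : ℝ, suppFun F a ≤ suppFun F b + R * |a - b| := by
    intro a b
    refine supp_le ⟨0, h0⟩ a fun z hz => ?_
    have h1 := le_supp hR b hz
    have h2 := (abs_le.1 (dirRe_lip a b z)).2
    have h3 : ‖z‖ * |a - b| ≤ R * |a - b| := mul_le_mul_of_nonneg_right (hR z hz) (abs_nonneg _)
    linarith
  rw [abs_le]
  have h1 := key θ φ
  have h2 := key φ θ
  rw [abs_sub_comm φ θ] at h2
  constructor <;> linarith

lemma supp_cont (hR : ∀ z ∈ F, ‖z‖ ≤ R) (h0 : (0:ℂ) ∈ F) : Continuous (suppFun F) := by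
  have hR0 : 0 ≤ R := by simpa using hR 0 h0
  have : LipschitzWith ⟨R, hR0⟩ (suppFun F) := LipschitzWith.of_dist_le_mul fun a b => by
    rw [Real.dist_eq, Real.dist_eq]; exact supp_lip hR h0 a b
  exact this.continuous

lemma supp_cos (hR : ∀ z ∈ F, ‖z‖ ≤ R) (h0 : (0:ℂ) ∈ F) (θ u : ℝ) :
    2 * Real.cos u * suppFun F θ ≤ suppFun F (θ + u) + suppFun F (θ - u) := by
  rcases le_or_gt (Real.cos u) 0 with hc | hc
  · have := supp_nonneg hR h0 θ
    have := supp_nonneg hR h0 (θ + u)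
    have := supp_nonneg hR h0 (θ - u)
    nlinarith
  · have : suppFun F θ ≤ (suppFun F (θ + u) + suppFun F (θ - u)) / (2 * Real.cos u) := by
      refine supp_le ⟨0, h0⟩ θ fun z hz => ?_
      rw [le_div_iff₀ (by positivity)]
      have h1 := le_supp hR (θ + u) hz
      have h2 := le_supp hR (θ - u) hz
      have : dirRe θ z * (2 * Real.cos u) = dirRe (θ + u) z + dirRe (θ - u) z := by
        simp only [dirRe, Real.cos_add, Real.cos_sub, Real.sin_add, Real.sin_sub]; ring
      linarith
    rw [le_div_iff₀ (by positivity)] at this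
    linarith
end supp

lemma supp_per (F : Set ℂ) (θ : ℝ) : suppFun F (θ + 2 * Real.pi) = suppFun F θ := by
  simp [suppFun, dirRe]

/-- Sliding average. -/
noncomputable def avg (ε : ℝ) (f : ℝ → ℝ) (θ : ℝ) : ℝ := (∫ x in (θ - ε)..(θ + ε), f x) / (2 * ε)

lemma avg_hasDeriv {ε : ℝ} {f : ℝ → ℝ} (hf : Continuous f) (θ : ℝ) :
    HasDerivAt (avg ε f) ((f (θ + ε) - f (θ - ε)) / (2 * ε)) θ := by
  have hI : ∀ b, HasDerivAt (fun u => ∫ x in (0:ℝ)..u, f x) (f b) b := fun b =>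
    intervalIntegral.integral_hasDerivAt_right (hf.intervalIntegrable _ _)
      (hf.stronglyMeasurableAtFilter _ _) hf.continuousAt
  have h1 : avg ε f = fun θ => ((∫ x in (0:ℝ)..(θ + ε), f x) - ∫ x in (0:ℝ)..(θ - ε), f x) / (2 * ε) := by
    funext t
    rw [avg, intervalIntegral.integral_interval_sub_left (hf.intervalIntegrable _ _)
      (hf.intervalIntegrable _ _)]
  rw [h1]
  refine HasDerivAt.div_const (HasDerivAt.sub ?_ ?_) _
  · exact (hI (θ + ε)).comp_add_const θ ε
  · exact (hI (θ - ε)).comp_sub_const θ ε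

lemma avg_cont {ε : ℝ} {f : ℝ → ℝ} (hf : Continuous f) : Continuous (avg ε f) :=
  continuous_iff_continuousAt.2 fun θ => (avg_hasDeriv hf θ).continuousAt

lemma avg_per {ε : ℝ} {f : ℝ → ℝ} (hf : ∀ x, f (x + 2 * Real.pi) = f x) (θ : ℝ) :
    avg ε f (θ + 2 * Real.pi) = avg ε f θ := by
  unfold avg
  congr 1
  have := intervalIntegral.integral_comp_add_right (a := θ - ε) (b := θ + ε) f (2 * Real.pi)
  simp only [hf] at this
  rw [this]
  congr 1 <;> ring

lemma avg_close {ε : ℝ} (hε : 0 < ε) {f h : ℝ → ℝ} {a R : ℝ} (hf : Continuous f) (hR : 0 ≤ R)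
    (hl : ∀ x y, |h x - h y| ≤ R * |x - y|) (ha : ∀ x, |f x - h x| ≤ a) (θ : ℝ) :
    |avg ε f θ - h θ| ≤ a + R * ε := by
  have h1 : avg ε f θ - h θ = (∫ x in (θ - ε)..(θ + ε), (f x - h θ)) / (2 * ε) := by
    rw [intervalIntegral.integral_sub (hf.intervalIntegrable _ _) (by simp), avg]
    simp
    field_simp
    ring
  rw [h1, abs_div, abs_of_pos (show 0 < 2 * ε by positivity), div_le_iff₀ (by positivity)]
  have := intervalIntegral.norm_integral_le_of_norm_le_const (a := θ - ε) (b := θ + ε)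
    (f := fun x => f x - h θ) (C := a + R * ε) (fun x hx => by
      rw [Set.uIoc_of_le (by linarith)] at hx
      rw [Real.norm_eq_abs]
      have h2 : |x - θ| ≤ ε := abs_le.2 ⟨by linarith [hx.1], by linarith [hx.2]⟩
      have h3 := abs_add_le (f x - h x) (h x - h θ)
      have h4 : R * |x - θ| ≤ R * ε := mul_le_mul_of_nonneg_left h2 hR
      have h5 := ha x
      have h6 := hl x θ
      rw [sub_add_sub_cancel] at h3
      linarith)
  rw [Real.norm_eq_abs] at this
  refine this.trans (le_of_eq ?_)
  rw [abs_of_pos (by linarith)]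
  ring

lemma mem_cthick {F : Set ℂ} (hF : IsCompact F) (hc : Convex ℝ F) (hne : F.Nonempty) {η : ℝ}
    (hη : 0 ≤ η) {s : ℂ} (h : ∀ φ, dirRe φ s ≤ suppFun F φ + η) : s ∈ Metric.cthickening η F := by
  obtain ⟨v, hv, hvn⟩ := exists_norm_eq_iInf_of_complete_convex hne hF.isComplete hc s
  rw [norm_eq_iInf_iff_real_inner_le_zero hc hv] at hvn
  refine Metric.mem_cthickening_of_dist_le s v η F hv ?_
  rw [dist_eq_norm]
  set φ := Complex.arg (s - v)
  have hre : ‖s - v‖ * Real.cos φ = (s - v).re := Complex.norm_mul_cos_arg _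
  have him : ‖s - v‖ * Real.sin φ = (s - v).im := Complex.norm_mul_sin_arg _
  rcases eq_or_lt_of_le (norm_nonneg (s - v)) with h0 | hpos
  · rw [← h0]; exact hη
  have hs : suppFun F φ ≤ dirRe φ v := by
    refine supp_le hne φ fun w hw => ?_
    have h1 := hvn w hw
    rw [Complex.inner] at h1
    simp only [Complex.mul_re, Complex.conj_re, Complex.conj_im] at h1
    rw [← hre, ← him] at h1
    have : ‖s - v‖ * (dirRe φ w - dirRe φ v) ≤ 0 := by
      simp only [dirRe]
      simp only [Complex.sub_re, Complex.sub_im] at h1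
      linarith
    nlinarith
  have h2 := h φ
  have h3 : dirRe φ s - dirRe φ v = ‖s - v‖ := by
    have : dirRe φ s - dirRe φ v = Real.cos φ * (s - v).re + Real.sin φ * (s - v).im := by
      simp only [dirRe, Complex.sub_re, Complex.sub_im]; ring
    rw [this, ← hre, ← him]
    linear_combination ‖s - v‖ * Real.sin_sq_add_cos_sq φ
  linarith

/-- If H plus its second derivative is nonnegative, then the curve with support function `H` lies in all supporting half planes. -/
lemma ode_ineq {H H1 H2 : ℝ → ℝ} (d1 : ∀ x, HasDerivAt H (H1 x) x) (d2 : ∀ x, HasDerivAt H1 (H2 x) x)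
    (hp : ∀ x, 0 ≤ H x + H2 x) (θ φ : ℝ) (hφ : |φ - θ| ≤ Real.pi) :
    H θ * Real.cos (φ - θ) + H1 θ * Real.sin (φ - θ) ≤ H φ := by
  set ψ : ℝ → ℝ := fun x => H1 x * Real.sin (φ - x) + H x * Real.cos (φ - x) with hψ
  have dψ : ∀ x, HasDerivAt ψ ((H x + H2 x) * Real.sin (φ - x)) x := by
    intro x
    have hi : HasDerivAt (fun x => φ - x) (-1) x := by simpa using (hasDerivAt_id x).const_sub φ
    have := ((d2 x).mul hi.sin).add ((d1 x).mul hi.cos)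
    refine this.congr_deriv ?_
    ring
  have hc : Continuous ψ := continuous_iff_continuousAt.2 fun x => (dψ x).continuousAt
  have e1 : ψ φ = H φ := by simp [hψ]
  have e2 : ψ θ = H θ * Real.cos (φ - θ) + H1 θ * Real.sin (φ - θ) := by simp [hψ]; ring
  rw [← e1, ← e2]
  rw [abs_le] at hφ
  rcases le_total θ φ with h | h
  · have hm : MonotoneOn ψ (Set.Icc θ φ) := by
      refine monotoneOn_of_deriv_nonneg (convex_Icc _ _) hc.continuousOn
        (fun x _ => (dψ x).differentiableAt.differentiableWithinAt) fun x hx => ?_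
      rw [(dψ x).deriv]
      rw [interior_Icc] at hx
      exact mul_nonneg (hp x) (Real.sin_nonneg_of_nonneg_of_le_pi (by linarith [hx.2]) (by linarith [hx.1]))
    exact hm ⟨le_rfl, h⟩ ⟨h, le_rfl⟩ h
  · have hm : AntitoneOn ψ (Set.Icc φ θ) := by
      refine antitoneOn_of_deriv_nonpos (convex_Icc _ _) hc.continuousOn
        (fun x _ => (dψ x).differentiableAt.differentiableWithinAt) fun x hx => ?_
      rw [(dψ x).deriv]
      rw [interior_Icc] at hx
      exact mul_nonpos_of_nonneg_of_nonpos (hp x)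
        (Real.sin_nonpos_of_nonpos_of_neg_pi_le (by linarith [hx.1]) (by linarith [hx.2]))
    exact hm ⟨le_rfl, h⟩ ⟨h, le_rfl⟩ h

lemma exists_near_angle (θ φ : ℝ) : ∃ φ' : ℝ, |φ' - θ| ≤ Real.pi ∧ ∃ n : ℤ, φ' = φ + n * (2 * Real.pi) := by
  refine ⟨θ + toIocMod (by positivity : 0 < 2 * Real.pi) (-Real.pi) (φ - θ), ?_,
    -toIocDiv (by positivity : 0 < 2 * Real.pi) (-Real.pi) (φ - θ), ?_⟩
  · have := toIocMod_mem_Ioc (by positivity : 0 < 2 * Real.pi) (-Real.pi) (φ - θ)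
    rw [abs_le]
    constructor <;> linarith [this.1, this.2]
  · have := toIocMod_add_toIocDiv_zsmul (by positivity : 0 < 2 * Real.pi) (-Real.pi) (φ - θ)
    rw [zsmul_eq_mul] at this
    push_cast
    linarith

lemma exists_curve {F : Set ℂ} (hF : IsCompact F) (hc : Convex ℝ F) (h0 : (0:ℂ) ∈ F) {η : ℝ}
    (hη : 0 < η) : ∃ c : CurveData, (∀ θ, c.σ θ ∈ Metric.cthickening η F) ∧
      ∀ θ, suppFun F θ + c.δ ≤ dirRe θ (c.σ θ) := by
  obtain ⟨R, hR⟩ := hF.isBounded.exists_norm_le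
  have hR0 : 0 ≤ R := by simpa using hR 0 h0
  set ε : ℝ := η / (8 * (R + 1)) with hεd
  have hε : 0 < ε := by positivity
  have hεR : 4 * R * ε ≤ η / 2 := by
    rw [hεd]
    have : 4 * R * (η / (8 * (R + 1))) = (η / 2) * (R / (R + 1)) := by field_simp; ring
    rw [this]
    have : R / (R + 1) ≤ 1 := by rw [div_le_one (by positivity)]; linarith
    nlinarith
  set h := suppFun F with hh
  have hcont : Continuous h := supp_cont hR h0
  have hlip := supp_lip hR h0
  have hper := supp_per F
  set h1 := avg ε h with hh1
  set h2 := avg ε h1 with hh2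
  have c1 : Continuous h1 := avg_cont hcont
  have k1 : ∀ x, |h1 x - h x| ≤ R * ε := fun x => by
    simpa using avg_close (a := 0) hε hcont hR0 hlip (fun x => by simp [hh]) x
  have k2 : ∀ x, |h2 x - h x| ≤ 2 * (R * ε) := fun x => by
    have := avg_close hε c1 hR0 hlip k1 x
    linarith
  have p1 : ∀ x, h1 (x + 2 * Real.pi) = h1 x := avg_per hper
  have p2 : ∀ x, h2 (x + 2 * Real.pi) = h2 x := avg_per p1
  set H : ℝ → ℝ := fun x => h2 x + (2 * (R * ε) + η / 2) with hH
  set H1 : ℝ → ℝ := fun x => (h1 (x + ε) - h1 (x - ε)) / (2 * ε) with hH1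
  set H2 : ℝ → ℝ := fun x => ((h (x + ε + ε) - h (x + ε - ε)) / (2 * ε)
    - (h (x - ε + ε) - h (x - ε - ε)) / (2 * ε)) / (2 * ε) with hH2
  have d1 : ∀ x, HasDerivAt H (H1 x) x := fun x => (avg_hasDeriv c1 x).add_const _
  have d2 : ∀ x, HasDerivAt H1 (H2 x) x := fun x => by
    have a1 := (avg_hasDeriv (ε := ε) hcont (x + ε)).comp_add_const x ε
    have a2 := (avg_hasDeriv (ε := ε) hcont (x - ε)).comp_sub_const x ε
    exact (a1.sub a2).div_const _
  have hpos : ∀ x, 0 ≤ H x + H2 x := by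
    intro x
    have e : H2 x = (h (x + 2 * ε) + h (x - 2 * ε) - 2 * h x) / (4 * ε ^ 2) := by
      simp only [hH2]
      rw [show x + ε + ε = x + 2 * ε by ring, show x + ε - ε = x by ring,
        show x - ε + ε = x by ring, show x - ε - ε = x - 2 * ε by ring]
      field_simp
      ring
    have hcos := supp_cos hR h0 x (2 * ε)
    have hcos2 := Real.one_sub_sq_div_two_le_cos (x := 2 * ε)
    have hn := supp_nonneg hR h0 x
    have : -h x ≤ H2 x := by
      rw [e, le_div_iff₀ (by positivity)]
      simp only [← hh] at hcos hn
      nlinarith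
    have k := (abs_le.1 (k2 x)).1
    simp only [hH]
    linarith
  have hHper : ∀ x, H (x + 2 * Real.pi) = H x := fun x => by simp only [hH, p2]
  have hH1per : ∀ x, H1 (x + 2 * Real.pi) = H1 x := fun x => by
    simp only [hH1]
    rw [show x + 2 * Real.pi + ε = x + ε + 2 * Real.pi by ring,
      show x + 2 * Real.pi - ε = x - ε + 2 * Real.pi by ring, p1, p1]
  have hHc : Continuous H := continuous_iff_continuousAt.2 fun x => (d1 x).continuousAt
  have hH2c : Continuous H2 := by
    simp only [hH2]
    fun_prop
  have hHh : ∀ x, h x + η / 2 ≤ H x := fun x => by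
    have := (abs_le.1 (k2 x)).1
    simp only [hH]; linarith
  have hHh' : ∀ x, H x ≤ h x + η := fun x => by
    have := (abs_le.1 (k2 x)).2
    simp only [hH]; linarith
  set σ : ℝ → ℂ := fun θ => Complex.exp (θ * Complex.I) * ((H θ : ℂ) + (H1 θ : ℂ) * Complex.I) with hσ
  have hdir : ∀ φ θ, dirRe φ (σ θ) = H θ * Real.cos (φ - θ) + H1 θ * Real.sin (φ - θ) := by
    intro φ θ
    simp only [dirRe, hσ, Complex.mul_re, Complex.mul_im, Complex.exp_ofReal_mul_I_re,
      Complex.exp_ofReal_mul_I_im, Complex.add_re, Complex.add_im, Complex.ofReal_re,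
      Complex.ofReal_im, Complex.I_re, Complex.I_im, Real.cos_sub, Real.sin_sub]
    ring
  have hdir0 : ∀ θ, dirRe θ (σ θ) = H θ := fun θ => by rw [hdir]; simp
  refine ⟨⟨σ, fun x => H x + H2 x, η / 2, by positivity, hHc.add hH2c, hpos, ?_, ?_, ?_⟩, ?_, ?_⟩
  · intro θ
    have e1 : HasDerivAt (fun θ : ℝ => Complex.exp (θ * Complex.I))
        (Complex.exp (θ * Complex.I) * Complex.I) θ := by
      have : HasDerivAt (fun θ : ℝ => (θ : ℂ) * Complex.I) (Complex.I) θ := by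
        simpa using (Complex.ofRealCLM.hasDerivAt (x := θ)).mul_const Complex.I
      exact this.cexp
    have e2 := e1.mul ((d1 θ).ofReal_comp.add ((d2 θ).ofReal_comp.mul_const Complex.I))
    refine e2.congr_deriv ?_
    simp only [Pi.add_apply]
    push_cast
    linear_combination (Complex.exp (θ * Complex.I) * (H1 θ : ℂ)) * Complex.I_mul_I
  · have a := hHper 0
    have b := hH1per 0
    rw [zero_add] at a b
    simp only [hσ, a, b]
    congr 1
    push_cast
    rw [Complex.exp_two_pi_mul_I]
    simp
  · intro θ
    show η / 2 ≤ dirRe θ (σ θ)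
    rw [hdir0]
    have := hHh θ
    have := supp_nonneg hR h0 θ
    linarith
  · intro θ
    refine mem_cthick hF hc ⟨0, h0⟩ hη.le fun φ => ?_
    show dirRe φ (σ θ) ≤ _
    obtain ⟨φ', hφ', n, hn⟩ := exists_near_angle θ φ
    have e := ode_ineq d1 d2 hpos θ φ' hφ'
    rw [← hdir] at e
    have hp1 : dirRe φ' (σ θ) = dirRe φ (σ θ) := by
      simp only [dirRe, hn, Real.cos_add_int_mul_two_pi, Real.sin_add_int_mul_two_pi]
    have hp2 : h φ' = h φ := by
      simp only [hh, suppFun, dirRe, hn, Real.cos_add_int_mul_two_pi, Real.sin_add_int_mul_two_pi]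
    rw [hp1] at e
    have := hHh' φ'
    rw [hp2] at this
    linarith
  · intro θ
    show h θ + η / 2 ≤ dirRe θ (σ θ)
    rw [hdir0]
    exact hHh θ

/-! ### Part 2: Cauchy integrals -/

/-- The derivative of the curve. -/
noncomputable def CurveData.dσ (c : CurveData) (θ : ℝ) : ℂ :=
  (c.ρ θ : ℂ) * (Complex.I * Complex.exp (θ * Complex.I))

lemma CurveData.σ_cont (c : CurveData) : Continuous c.σ :=
  continuous_iff_continuousAt.2 fun θ => (c.hd θ).continuousAt

lemma CurveData.dσ_cont (c : CurveData) : Continuous c.dσ := by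
  have := c.hρc
  unfold CurveData.dσ
  fun_prop

lemma dirRe_eq (θ : ℝ) (z : ℂ) : dirRe θ z = (Complex.exp (-(θ * Complex.I)) * z).re := by
  rw [← neg_mul]
  have : (-(θ:ℂ)) = ((-θ : ℝ) : ℂ) := by push_cast; ring
  rw [this, Complex.mul_re, Complex.exp_ofReal_mul_I_re, Complex.exp_ofReal_mul_I_im, dirRe]
  simp

lemma CurveData.σ_ne (c : CurveData) (θ : ℝ) : c.σ θ ≠ 0 := by
  intro h
  have := c.h0 θ
  rw [h] at this
  have h2 := c.hδ
  simp [dirRe] at this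
  linarith

lemma CurveData.winding (c : CurveData) :
    ∫ θ in (0:ℝ)..(2 * Real.pi), c.dσ θ * (c.σ θ)⁻¹ = 2 * Real.pi * Complex.I := by
  have hd : ∀ θ ∈ Set.uIcc 0 (2 * Real.pi), HasDerivAt
      (fun θ : ℝ => Complex.log (Complex.exp (-(θ * Complex.I)) * c.σ θ))
      (c.dσ θ * (c.σ θ)⁻¹ - Complex.I) θ := by
    intro θ _
    have e1 : HasDerivAt (fun θ : ℝ => Complex.exp (-(θ * Complex.I)))
        (Complex.exp (-(θ * Complex.I)) * (-Complex.I)) θ := by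
      have : HasDerivAt (fun θ : ℝ => -((θ : ℂ) * Complex.I)) (-Complex.I) θ := by
        simpa using ((Complex.ofRealCLM.hasDerivAt (x := θ)).mul_const Complex.I).fun_neg
      exact this.cexp
    have e2 := (e1.fun_mul (c.hd θ)).clog_real (by
      left
      rw [← dirRe_eq]
      exact c.hδ.trans_le (c.h0 θ))
    refine e2.congr_deriv ?_
    have h1 := c.σ_ne θ
    have h2 := Complex.exp_ne_zero (-(θ * Complex.I))
    unfold CurveData.dσ
    field_simp
    ring
  have hcont : Continuous fun θ => c.dσ θ * (c.σ θ)⁻¹ :=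
    c.dσ_cont.mul (c.σ_cont.inv₀ c.σ_ne)
  have := intervalIntegral.integral_eq_sub_of_hasDerivAt hd
    ((hcont.sub continuous_const).intervalIntegrable _ _)
  rw [intervalIntegral.integral_sub (hcont.intervalIntegrable _ _) (by simp)] at this
  rw [c.per] at this
  push_cast at this
  rw [Complex.exp_neg, Complex.exp_two_pi_mul_I] at this
  simp at this
  linear_combination this

lemma isUnit_of_far {𝔸 : Type*} [NormedRing 𝔸] [NormedAlgebra ℂ 𝔸] [CompleteSpace 𝔸] (x : 𝔸)
    (s d : ℂ) (h : ‖x - d • (1:𝔸)‖ < ‖s - d‖) : IsUnit (s • (1:𝔸) - x) := by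
  have hpos : 0 < ‖s - d‖ := (norm_nonneg _).trans_lt h
  have hne : s - d ≠ 0 := norm_pos_iff.1 hpos
  have h1 : s • (1:𝔸) - x = (s - d) • (1 - (s - d)⁻¹ • (x - d • (1:𝔸))) := by
    rw [smul_sub, smul_smul, mul_inv_cancel₀ hne, one_smul, sub_smul]
    abel
  rw [h1]
  have h2 : IsUnit (1 - (s - d)⁻¹ • (x - d • (1:𝔸))) := by
    apply isUnit_one_sub_of_norm_lt_one
    rw [norm_smul, norm_inv, inv_mul_lt_iff₀ hpos, mul_one]
    exact h
  exact h2.smul (Units.mk0 _ hne)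

section op
variable {H : Type*} [NormedAddCommGroup H] [InnerProductSpace ℂ H]

/-- The numerical range of `A` lies strictly inside the curve. -/
def CurveData.Inside (c : CurveData) (A : H →L[ℂ] H) : Prop :=
  ∀ θ y, dirRe θ (inner ℂ y (A y)) + c.δ * ‖y‖ ^ 2 ≤ dirRe θ (c.σ θ) * ‖y‖ ^ 2

lemma dirRe_exp (θ : ℝ) (z : ℂ) : dirRe θ z = ((starRingEnd ℂ) (Complex.exp (θ * Complex.I)) * z).re := by
  rw [dirRe_eq, ← Complex.exp_conj]
  simp

lemma CurveData.far (c : CurveData) {A : H →L[ℂ] H} (hA : c.Inside A) (θ : ℝ) {s : ℝ} (hs : 0 ≤ s)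
    (hs2 : ‖A‖ ^ 2 < 2 * s * c.δ) :
    ‖A - (-(s : ℂ) * Complex.exp (θ * Complex.I)) • (1 : H →L[ℂ] H)‖ <
      ‖c.σ θ - (-(s : ℂ) * Complex.exp (θ * Complex.I))‖ := by
  set e := Complex.exp (θ * Complex.I) with he
  have hen : ‖e‖ = 1 := by rw [he, Complex.norm_exp_ofReal_mul_I]
  set d := dirRe θ (c.σ θ) with hd
  have hdδ : c.δ ≤ d := c.h0 θ
  have hδ := c.hδ
  have hr : ‖c.σ θ - (-(s : ℂ) * e)‖ ^ 2 = ‖c.σ θ‖ ^ 2 + 2 * s * d + s ^ 2 := by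
    have e1 : c.σ θ - (-(s : ℂ) * e) = c.σ θ + s * e := by ring
    rw [e1, Complex.sq_norm, Complex.normSq_add, ← Complex.sq_norm, ← Complex.sq_norm, norm_mul, hen]
    have : (c.σ θ * (starRingEnd ℂ) (s * e)).re = s * d := by
      rw [hd, dirRe_exp, map_mul, Complex.conj_ofReal, ← Complex.re_ofReal_mul]
      congr 1
      ring
    rw [this]
    simp
    ring
  have hl : ‖A - (-(s : ℂ) * e) • (1 : H →L[ℂ] H)‖ ≤ Real.sqrt (‖A‖ ^ 2 + 2 * s * (d - c.δ) + s ^ 2) := by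
    refine ContinuousLinearMap.opNorm_le_bound _ (Real.sqrt_nonneg _) fun y => ?_
    rw [← Real.sqrt_sq (norm_nonneg y), ← Real.sqrt_mul (by
      have : 0 ≤ d - c.δ := by linarith
      positivity)]
    refine Real.le_sqrt_of_sq_le ?_
    have e1 : (A - (-(s : ℂ) * e) • (1 : H →L[ℂ] H)) y = A y + ((s:ℂ) * e) • y := by
      simp [neg_mul]
    rw [e1, @norm_add_sq ℂ]
    have e2 : RCLike.re (inner ℂ (A y) (((s:ℂ) * e) • y)) = s * dirRe θ (inner ℂ y (A y)) := by
      rw [inner_smul_right, ← inner_conj_symm, dirRe_exp, ← Complex.re_ofReal_mul]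
      rw [← Complex.conj_re]
      simp [mul_assoc, he]
    rw [e2, norm_smul, norm_mul, hen, Complex.norm_real, Real.norm_eq_abs, mul_one, mul_pow, sq_abs]
    have h1 := hA θ y
    have h2 : ‖A y‖ ^ 2 ≤ ‖A‖ ^ 2 * ‖y‖ ^ 2 := by
      rw [← mul_pow]; gcongr; exact A.le_opNorm y
    rw [← hd] at h1
    nlinarith
  refine hl.trans_lt ?_
  rw [Real.sqrt_lt' ?_]
  · rw [hr]
    nlinarith [sq_nonneg ‖c.σ θ‖]
  · have : 0 < ‖c.σ θ - (-(s : ℂ) * e)‖ ^ 2 := by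
      rw [hr]
      have := sq_nonneg ‖A‖
      have : 0 < 2 * s * d := by nlinarith
      positivity
    exact lt_of_le_of_ne (norm_nonneg _) (Ne.symm (sq_pos_iff.1 this))

/-- resolvent -/
noncomputable def resv {𝔸 : Type*} [Ring 𝔸] [Algebra ℂ 𝔸] (x : 𝔸) (s : ℂ) : 𝔸 :=
  Ring.inverse (s • (1:𝔸) - x)

variable [CompleteSpace H]

lemma CurveData.isUnit (c : CurveData) {A : H →L[ℂ] H} (hA : c.Inside A) (θ : ℝ) :
    IsUnit (c.σ θ • (1 : H →L[ℂ] H) - A) := by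
  have hδ := c.hδ
  refine isUnit_of_far A _ _ (c.far hA θ (s := (‖A‖ ^ 2 + 1) / (2 * c.δ)) (by positivity) ?_)
  field_simp
  linarith

lemma CurveData.res_norm (c : CurveData) {A : H →L[ℂ] H} (hA : c.Inside A) (θ : ℝ) :
    ‖resv A (c.σ θ)‖ ≤ 1 / c.δ := by
  have hδ := c.hδ
  refine ContinuousLinearMap.opNorm_le_bound _ (by positivity) fun y => ?_
  set w := resv A (c.σ θ) y with hw
  have hy : y = c.σ θ • w - A w := by
    have := congrArg (fun T : H →L[ℂ] H => T y) (Ring.mul_inverse_cancel _ (c.isUnit hA θ))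
    simpa [hw, resv] using this.symm
  have h1 := hA θ w
  have h2 : dirRe θ (inner ℂ w y) = dirRe θ (c.σ θ) * ‖w‖ ^ 2 - dirRe θ (inner ℂ w (A w)) := by
    rw [hy, inner_sub_right, inner_smul_right, inner_self_eq_norm_sq_to_K]
    have : ((‖w‖ : ℂ)) ^ 2 = ((‖w‖ ^ 2 : ℝ) : ℂ) := by push_cast; rfl
    simp only [dirRe, Complex.sub_re, Complex.sub_im, Complex.coe_algebraMap, this, Complex.re_mul_ofReal, Complex.im_mul_ofReal]
    ring
  have h3 : c.δ * ‖w‖ ^ 2 ≤ ‖w‖ * ‖y‖ := by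
    have := (le_abs_self _).trans (dirRe_le_norm θ (inner ℂ w y))
    have := norm_inner_le_norm (𝕜 := ℂ) w y
    linarith
  rw [div_mul_eq_mul_div, one_mul, le_div_iff₀ hδ]
  rcases eq_or_lt_of_le (norm_nonneg w) with h | h
  · rw [← h]; simp
  · have : ‖w‖ * (‖w‖ * c.δ) ≤ ‖w‖ * ‖y‖ := by linarith
    exact le_of_mul_le_mul_left this h

lemma CurveData.res_cont (c : CurveData) {A : H →L[ℂ] H} (hA : c.Inside A) :
    Continuous fun θ => resv A (c.σ θ) := by
  refine continuous_iff_continuousAt.2 fun θ => ?_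
  obtain ⟨u, hu⟩ := c.isUnit hA θ
  have h1 : ContinuousAt Ring.inverse (c.σ θ • (1 : H →L[ℂ] H) - A) := by
    rw [← hu]; exact NormedRing.inverse_continuousAt u
  exact ContinuousAt.comp (f := fun θ => c.σ θ • (1 : H →L[ℂ] H) - A) h1
    ((c.σ_cont.smul continuous_const).sub continuous_const).continuousAt

lemma CurveData.res_deriv (c : CurveData) {A : H →L[ℂ] H} (hA : c.Inside A) (θ : ℝ) :
    HasDerivAt (fun θ => resv A (c.σ θ)) (-(c.dσ θ • (resv A (c.σ θ) * resv A (c.σ θ)))) θ := by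
  obtain ⟨u, hu⟩ := c.isUnit hA θ
  have h1 := hasFDerivAt_ringInverse (𝕜 := ℝ) u
  rw [hu] at h1
  have h2 : HasDerivAt (fun θ => c.σ θ • (1 : H →L[ℂ] H) - A) (c.dσ θ • (1 : H →L[ℂ] H)) θ :=
    ((c.hd θ).smul_const _).sub_const _
  have h3 := h1.comp_hasDerivAt θ h2
  refine h3.congr_deriv ?_
  have : resv A (c.σ θ) = ↑u⁻¹ := by rw [resv, ← hu, Ring.inverse_unit]
  rw [this]
  simp

lemma CurveData.inside_smul (c : CurveData) {A : H →L[ℂ] H} (hA : c.Inside A) {t : ℝ} (h0 : 0 ≤ t)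
    (h1 : t ≤ 1) : c.Inside ((t : ℂ) • A) := by
  intro θ y
  have e : dirRe θ (inner ℂ y (((t : ℂ) • A) y)) = t * dirRe θ (inner ℂ y (A y)) := by
    rw [_root_.smul_apply, inner_smul_right]
    simp only [dirRe, Complex.re_ofReal_mul, Complex.im_ofReal_mul]
    ring
  rw [e]
  have h2 := hA θ y
  have h3 := c.h0 θ
  have h4 := sq_nonneg ‖y‖
  nlinarith [mul_nonneg (sub_nonneg.2 h1) (mul_nonneg (sub_nonneg.2 h3) h4)]

lemma res_sub {𝔸 : Type*} [Ring 𝔸] [Algebra ℂ 𝔸] {A B : 𝔸} {s : ℂ} (hA : IsUnit (s • (1:𝔸) - A))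
    (hB : IsUnit (s • (1:𝔸) - B)) : resv A s - resv B s = resv A s * (A - B) * resv B s := by
  have h1 := Ring.inverse_mul_cancel _ hA
  have h2 := Ring.mul_inverse_cancel _ hB
  have h3 : A - B = (s • (1:𝔸) - B) - (s • (1:𝔸) - A) := by abel
  rw [h3, mul_sub, sub_mul, resv, resv, mul_assoc, h2, h1]
  simp

lemma res_comm {𝔸 : Type*} [Ring 𝔸] [Algebra ℂ 𝔸] {A : 𝔸} {s : ℂ} (hA : IsUnit (s • (1:𝔸) - A)) :
    A * resv A s = resv A s * A := by
  have h1 := Ring.inverse_mul_cancel _ hA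
  have h2 := Ring.mul_inverse_cancel _ hA
  rw [sub_mul] at h2
  rw [mul_sub] at h1
  simp only [smul_mul_assoc, one_mul, mul_smul_comm, mul_one] at h1 h2
  unfold resv
  have := h1.trans h2.symm
  exact (sub_right_inj.1 this).symm

lemma CurveData.res_int (c : CurveData) {A : H →L[ℂ] H} (hA : c.Inside A) :
    ∫ θ in (0:ℝ)..(2 * Real.pi), c.dσ θ • resv A (c.σ θ) = (2 * Real.pi * Complex.I) • (1 : H →L[ℂ] H) := by
  have hδ := c.hδ
  set G : ℝ → (H →L[ℂ] H) := fun t => ∫ θ in (0:ℝ)..(2 * Real.pi), c.dσ θ • resv ((t : ℂ) • A) (c.σ θ) with hG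
  have hin : ∀ t ∈ Set.Icc (0:ℝ) 1, c.Inside ((t : ℂ) • A) := fun t ht => c.inside_smul hA ht.1 ht.2
  obtain ⟨M, hM⟩ : ∃ M, ∀ θ ∈ Set.uIcc 0 (2 * Real.pi), ‖c.dσ θ‖ ≤ M := by
    obtain ⟨M, hM⟩ := (isCompact_uIcc (a := (0:ℝ)) (b := 2 * Real.pi)).exists_bound_of_continuousOn c.dσ_cont.continuousOn
    exact ⟨M, hM⟩
  have hM0 : 0 ≤ M := (norm_nonneg _).trans (hM 0 (by simp))
  -- the integral of the squared resolvent vanishes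
  have hz : ∀ t ∈ Set.Icc (0:ℝ) 1, ∫ θ in (0:ℝ)..(2 * Real.pi),
      c.dσ θ • (resv ((t : ℂ) • A) (c.σ θ) * A * resv ((t : ℂ) • A) (c.σ θ)) = 0 := by
    intro t ht
    have hI := hin t ht
    have hcont := c.res_cont hI
    have hdc := c.dσ_cont
    have hd : ∀ θ ∈ Set.uIcc 0 (2 * Real.pi), HasDerivAt (fun θ => - (resv ((t : ℂ) • A) (c.σ θ) * A))
        (c.dσ θ • (resv ((t : ℂ) • A) (c.σ θ) * A * resv ((t : ℂ) • A) (c.σ θ))) θ := by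
      intro θ _
      refine ((c.res_deriv hI θ).mul_const A).fun_neg.congr_deriv ?_
      have hcomm : A * resv ((t : ℂ) • A) (c.σ θ) = resv ((t : ℂ) • A) (c.σ θ) * A := by
        obtain ⟨u, hu⟩ := c.isUnit hI θ
        have h3 : Commute A (c.σ θ • (1 : H →L[ℂ] H) - (t : ℂ) • A) :=
          ((Commute.one_right A).smul_right _).sub_right ((Commute.refl A).smul_right _)
        rw [resv, ← hu, Ring.inverse_unit]
        rw [← hu] at h3
        exact h3.units_inv_right.eq
      rw [mul_assoc _ A, hcomm]
      simp [mul_assoc]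
    rw [intervalIntegral.integral_eq_sub_of_hasDerivAt hd
      ((hdc.smul ((hcont.mul continuous_const).mul hcont)).intervalIntegrable _ _), c.per]
    simp
  set C : ℝ := M * (1 / c.δ * ‖A‖ * (1 / c.δ) * ‖A‖ * (1 / c.δ)) * (2 * Real.pi) with hC
  have hquad : ∀ t ∈ Set.Icc (0:ℝ) 1, ∀ s ∈ Set.Icc (0:ℝ) 1, ‖G t - G s‖ ≤ C * |t - s| ^ 2 := by
    intro t ht s hs
    have It := hin t ht
    have Is := hin s hs
    have ct := c.res_cont It
    have cs := c.res_cont Is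
    have hdc := c.dσ_cont
    have e1 : G t - G s = (t - s : ℂ) ^ 2 • ∫ θ in (0:ℝ)..(2 * Real.pi), c.dσ θ •
        (resv ((t : ℂ) • A) (c.σ θ) * A * resv ((s : ℂ) • A) (c.σ θ) * A * resv ((s : ℂ) • A) (c.σ θ)) := by
      have e2 : G t - G s - (t - s : ℂ) • (0 : H →L[ℂ] H) = (t - s : ℂ) ^ 2 • ∫ θ in (0:ℝ)..(2 * Real.pi), c.dσ θ •
        (resv ((t : ℂ) • A) (c.σ θ) * A * resv ((s : ℂ) • A) (c.σ θ) * A * resv ((s : ℂ) • A) (c.σ θ)) := by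
        rw [← hz s hs, hG]
        simp only
        have i1 : IntervalIntegrable (fun θ => c.dσ θ • resv ((t : ℂ) • A) (c.σ θ))
          MeasureTheory.volume 0 (2 * Real.pi) := (hdc.smul ct).intervalIntegrable _ _
        have i2 : IntervalIntegrable (fun θ => c.dσ θ • resv ((s : ℂ) • A) (c.σ θ))
          MeasureTheory.volume 0 (2 * Real.pi) := (hdc.smul cs).intervalIntegrable _ _
        have i3 : IntervalIntegrable (fun θ => (t - s : ℂ) • c.dσ θ • (resv ((s : ℂ) • A) (c.σ θ) * A *
            resv ((s : ℂ) • A) (c.σ θ))) MeasureTheory.volume 0 (2 * Real.pi) :=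
          Continuous.intervalIntegrable (by fun_prop) _ _
        have i4 : IntervalIntegrable (fun θ => c.dσ θ • resv ((t : ℂ) • A) (c.σ θ)
          - c.dσ θ • resv ((s : ℂ) • A) (c.σ θ)) MeasureTheory.volume 0 (2 * Real.pi) := i1.sub i2
        rw [← intervalIntegral.integral_smul, ← intervalIntegral.integral_smul,
          ← intervalIntegral.integral_sub i1 i2, ← intervalIntegral.integral_sub i4 i3]
        congr 1
        funext θ
        have r := res_sub (c.isUnit It θ) (c.isUnit Is θ)
        have r2 : resv ((t : ℂ) • A) (c.σ θ) - resv ((s : ℂ) • A) (c.σ θ)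
          = (t - s : ℂ) • (resv ((t : ℂ) • A) (c.σ θ) * A * resv ((s : ℂ) • A) (c.σ θ)) := by
          rw [r, ← sub_smul]; simp
        rw [← smul_sub, smul_comm (t - s : ℂ) (c.dσ θ), ← smul_sub, smul_comm _ (c.dσ θ)]
        congr 1
        rw [r2, ← smul_sub, ← sub_mul, ← sub_mul, r2, pow_two, mul_smul]
        simp
      simpa using e2
    rw [e1, norm_smul, norm_pow, mul_comm]
    have : ‖(t - s : ℂ)‖ = |t - s| := by
      rw [← Complex.ofReal_sub, Complex.norm_real, Real.norm_eq_abs]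
    rw [this]
    gcongr
    refine (intervalIntegral.norm_integral_le_of_norm_le_const (C := M * (1 / c.δ * ‖A‖ * (1 / c.δ) * ‖A‖ * (1 / c.δ))) ?_).trans (le_of_eq ?_)
    · intro θ hθ
      rw [norm_smul]
      have nt := c.res_norm It θ
      have ns := c.res_norm Is θ
      refine mul_le_mul (hM θ (Set.uIoc_subset_uIcc hθ)) ?_ (norm_nonneg _) hM0
      refine (norm_mul_le _ _).trans (mul_le_mul ?_ ns (norm_nonneg _) (by positivity))
      refine (norm_mul_le _ _).trans (mul_le_mul_of_nonneg_right ?_ (norm_nonneg _))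
      refine (norm_mul_le _ _).trans (mul_le_mul ?_ ns (norm_nonneg _) (by positivity))
      exact (norm_mul_le _ _).trans (mul_le_mul_of_nonneg_right nt (norm_nonneg _))
    · rw [hC, sub_zero, abs_of_pos (by positivity)]
  have hC0 : 0 ≤ C := by positivity
  have hderiv : ∀ x ∈ Set.Icc (0:ℝ) 1, HasDerivWithinAt G 0 (Set.Icc 0 1) x := by
    intro x hx
    rw [hasDerivWithinAt_iff_isLittleO]
    simp only [smul_zero, sub_zero]
    have hO : (fun x' => G x' - G x) =O[nhdsWithin x (Set.Icc 0 1)] fun x' => |x' - x| ^ 2 := by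
      refine Asymptotics.IsBigO.of_bound C ?_
      filter_upwards [self_mem_nhdsWithin] with y hy
      have := hquad y hy x hx
      rwa [Real.norm_of_nonneg (by positivity)]
    refine hO.trans_isLittleO ?_
    have : (fun x' : ℝ => (x' - x) ^ 2) =o[nhds x] fun x' => x' - x := by
      have := Asymptotics.isLittleO_pow_sub_sub x (m := 2) (by norm_num)
      simpa using this
    simpa using this.mono nhdsWithin_le_nhds
  have hconst := constant_of_derivWithin_zero (f := G) (a := 0) (b := 1)
    (fun x hx => (hderiv x hx).differentiableWithinAt) (fun x hx =>
      (hderiv x ⟨hx.1, hx.2.le⟩).derivWithin (uniqueDiffOn_Icc zero_lt_one x ⟨hx.1, hx.2.le⟩))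
    1 (by simp)
  have g1 : G 1 = ∫ θ in (0:ℝ)..(2 * Real.pi), c.dσ θ • resv A (c.σ θ) := by simp [hG]
  have g0 : G 0 = (2 * Real.pi * Complex.I) • (1 : H →L[ℂ] H) := by
    rw [← c.winding, ← intervalIntegral.integral_smul_const]
    simp only [hG]
    congr 1
    funext θ
    have : resv (((0:ℝ) : ℂ) • A) (c.σ θ) = (c.σ θ)⁻¹ • (1 : H →L[ℂ] H) := by
      have hne := c.σ_ne θ
      have hu : (((Units.mk0 _ hne) • (1 : (H →L[ℂ] H)ˣ) : (H →L[ℂ] H)ˣ) : H →L[ℂ] H) = c.σ θ • (1 : H →L[ℂ] H) := by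
        rfl
      simp only [Complex.ofReal_zero, zero_smul, resv, sub_zero]
      rw [← hu, Ring.inverse_unit]
      rfl
    rw [this, smul_smul]
  rw [← g1, hconst, g0]

/-- Cauchy's formula for polynomials of operators. -/
lemma CurveData.cauchy (c : CurveData) {A : H →L[ℂ] H} (hA : c.Inside A) (p : ℂ[X]) :
    ∫ θ in (0:ℝ)..(2 * Real.pi), (p.eval (c.σ θ) * c.dσ θ) • resv A (c.σ θ)
      = (2 * Real.pi * Complex.I) • aeval A p := by
  have hc := c.res_cont hA
  have hdc := c.dσ_cont
  have hσ := c.σ_cont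
  have mono : ∀ n : ℕ, ∫ θ in (0:ℝ)..(2 * Real.pi), ((c.σ θ) ^ n * c.dσ θ) • resv A (c.σ θ)
      = (2 * Real.pi * Complex.I) • A ^ n := by
    intro n
    induction n with
    | zero => simpa using c.res_int hA
    | succ n ih =>
      have e1 : ∀ θ, ((c.σ θ) ^ (n + 1) * c.dσ θ) • resv A (c.σ θ)
          = A * (((c.σ θ) ^ n * c.dσ θ) • resv A (c.σ θ)) + ((c.σ θ) ^ n * c.dσ θ) • (1 : H →L[ℂ] H) := by
        intro θ
        have h2 := Ring.mul_inverse_cancel _ (c.isUnit hA θ)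
        rw [sub_mul, smul_mul_assoc, one_mul, sub_eq_iff_eq_add] at h2
        rw [pow_succ, mul_right_comm, mul_smul, resv, h2, smul_add, mul_smul_comm, add_comm]
      have e2 : ∫ θ in (0:ℝ)..(2 * Real.pi), (c.σ θ) ^ n * c.dσ θ = 0 := by
        have hd : ∀ θ ∈ Set.uIcc 0 (2 * Real.pi), HasDerivAt (fun θ => (c.σ θ) ^ (n + 1) / ((n:ℂ) + 1))
            ((c.σ θ) ^ n * c.dσ θ) θ := by
          intro θ _
          refine (((c.hd θ).fun_pow (n + 1)).div_const _).congr_deriv ?_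
          have : (n:ℂ) + 1 ≠ 0 := by exact_mod_cast n.succ_ne_zero
          simp only [CurveData.dσ]
          push_cast
          field_simp
        rw [intervalIntegral.integral_eq_sub_of_hasDerivAt hd (((hσ.pow n).mul hdc).intervalIntegrable _ _), c.per]
        simp
      simp only [e1]
      rw [intervalIntegral.integral_add, intervalIntegral.integral_smul_const, e2, zero_smul, add_zero]
      · have := ContinuousLinearMap.intervalIntegral_comp_comm (μ := MeasureTheory.volume) (ContinuousLinearMap.mul ℂ (H →L[ℂ] H) A)
          (show IntervalIntegrable (fun θ => ((c.σ θ) ^ n * c.dσ θ) • resv A (c.σ θ)) MeasureTheory.volume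
            (0:ℝ) (2 * Real.pi) from (((hσ.pow n).mul hdc).smul hc).intervalIntegrable _ _)
        simp only [ContinuousLinearMap.mul_apply'] at this
        rw [this, ih, mul_smul_comm, pow_succ']
      · exact (continuous_const.mul (((hσ.pow n).mul hdc).smul hc)).intervalIntegrable _ _
      · exact (((hσ.pow n).mul hdc).smul continuous_const).intervalIntegrable _ _
  induction p using Polynomial.induction_on' with
  | add p q hp hq =>
    simp only [eval_add, add_mul, add_smul, map_add, smul_add]
    rw [intervalIntegral.integral_add, hp, hq]
    · exact (((p.continuous.comp hσ).mul hdc).smul hc).intervalIntegrable _ _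
    · exact (((q.continuous.comp hσ).mul hdc).smul hc).intervalIntegrable _ _
  | monomial n a =>
    have e : ∀ θ, (((monomial n) a).eval (c.σ θ) * c.dσ θ) • resv A (c.σ θ)
        = a • (((c.σ θ) ^ n * c.dσ θ) • resv A (c.σ θ)) := fun θ => by
      rw [eval_monomial, smul_smul, mul_assoc]
    simp only [e]
    rw [intervalIntegral.integral_smul, mono, aeval_monomial, ← Algebra.smul_def, smul_comm]
end op

/-! ### Part 3: the double layer bound -/
section op3
variable {H : Type*} [NormedAddCommGroup H] [InnerProductSpace ℂ H]

lemma pos_form (T : H →L[ℂ] H) (hT : ∀ y, 0 ≤ (inner ℂ y (T y)).re) (u v : H) :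
    ‖inner ℂ u (T v) + inner ℂ (T u) v‖ ≤ (inner ℂ u (T u)).re + (inner ℂ v (T v)).re := by
  have h1 : ∀ v, (inner ℂ u (T v) + inner ℂ (T u) v).re ≤ (inner ℂ u (T u)).re + (inner ℂ v (T v)).re := by
    intro v
    have h := hT (u - v)
    rw [map_sub, inner_sub_left, inner_sub_right, inner_sub_right] at h
    have h2 : (inner ℂ v (T u)).re = (inner ℂ (T u) v).re := by
      rw [← inner_conj_symm, Complex.conj_re]
    simp only [Complex.sub_re, Complex.add_re] at h ⊢
    linarith
  set q := inner ℂ u (T v) + inner ℂ (T u) v with hq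
  by_cases h0 : q = 0
  · rw [h0, norm_zero]
    exact add_nonneg (hT u) (hT v)
  have hn : (‖q‖ : ℂ) ≠ 0 := by exact_mod_cast norm_ne_zero_iff.2 h0
  set ω : ℂ := (starRingEnd ℂ) q / ‖q‖ with hω
  have hω1 : (starRingEnd ℂ) ω * ω = 1 := by
    rw [← Complex.normSq_eq_conj_mul_self, Complex.normSq_eq_norm_sq, hω]
    simp [norm_ne_zero_iff.2 h0]
  have h3 := h1 (ω • v)
  have e1 : inner ℂ u (T (ω • v)) + inner ℂ (T u) (ω • v) = (‖q‖ : ℂ) := by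
    rw [map_smul, inner_smul_right, inner_smul_right, ← mul_add, ← hq, hω, div_mul_eq_mul_div,
      ← Complex.normSq_eq_conj_mul_self, Complex.normSq_eq_norm_sq]
    field_simp
    push_cast
    rfl
  have e2 : inner ℂ (ω • v) (T (ω • v)) = inner ℂ v (T v) := by
    rw [map_smul, inner_smul_right, inner_smul_left, ← mul_assoc, mul_comm ω, hω1, one_mul]
  rw [e1, e2, Complex.ofReal_re] at h3
  exact h3

/-- The functional `T ↦ ⟪u, T v⟫`. -/
noncomputable def vecFun (u v : H) : (H →L[ℂ] H) →L[ℂ] ℂ :=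
  (innerSL ℂ u).comp (ContinuousLinearMap.apply ℂ H v)

lemma vecFun_apply (u v : H) (T : H →L[ℂ] H) : vecFun u v T = inner ℂ u (T v) := rfl

variable [CompleteSpace H]

/-- Cauchy transform of the conjugate of `p`. -/
noncomputable def CurveData.g (c : CurveData) {𝔸 : Type*} [NormedRing 𝔸] [NormedAlgebra ℂ 𝔸] (x : 𝔸) (p : ℂ[X]) : 𝔸 :=
  (2 * Real.pi * Complex.I)⁻¹ • ∫ θ in (0:ℝ)..(2 * Real.pi),
    ((starRingEnd ℂ) (p.eval (c.σ θ)) * c.dσ θ) • resv x (c.σ θ)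

lemma CurveData.weight (c : CurveData) (θ : ℝ) :
    (2 * Real.pi * Complex.I)⁻¹ * c.dσ θ = ((c.ρ θ / (2 * Real.pi) : ℝ) : ℂ) * Complex.exp (θ * Complex.I) := by
  unfold CurveData.dσ
  have := Complex.I_ne_zero
  have : (Real.pi : ℂ) ≠ 0 := by exact_mod_cast Real.pi_ne_zero
  push_cast
  field_simp

lemma CurveData.vec_int (c : CurveData) {A : H →L[ℂ] H} (hA : c.Inside A) {f : ℝ → ℂ} (hf : Continuous f)
    (u v : H) : inner ℂ u (((2 * Real.pi * Complex.I)⁻¹ • ∫ θ in (0:ℝ)..(2 * Real.pi),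
      (f θ * c.dσ θ) • resv A (c.σ θ)) v) = ∫ θ in (0:ℝ)..(2 * Real.pi),
      f θ * ((c.ρ θ / (2 * Real.pi) : ℝ) : ℂ) * (inner ℂ u ((Complex.exp (θ * Complex.I) • resv A (c.σ θ)) v)) := by
  have hc := c.res_cont hA
  have hdc := c.dσ_cont
  rw [← vecFun_apply, ← intervalIntegral.integral_smul, ← ContinuousLinearMap.intervalIntegral_comp_comm]
  · congr 1
    funext θ
    have := c.weight θ
    rw [smul_smul, map_smul, vecFun_apply, _root_.smul_apply, inner_smul_right, smul_eq_mul,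
      mul_left_comm, this]
    ring
  · exact Continuous.intervalIntegrable (by fun_prop) _ _

lemma CurveData.S_bound (c : CurveData) {A : H →L[ℂ] H} (hA : c.Inside A) (p : ℂ[X]) {M : ℝ}
    (hM : ∀ θ, ‖p.eval (c.σ θ)‖ ≤ M) :
    ‖aeval A p + star (c.g A p)‖ ≤ 2 * M := by
  have hM0 : 0 ≤ M := (norm_nonneg _).trans (hM 0)
  have hc := c.res_cont hA
  have hρc := c.hρc
  have hσ := c.σ_cont
  have hpσ : Continuous fun θ => p.eval (c.σ θ) := p.continuous.comp hσ
  have hπ : (2 * Real.pi * Complex.I) ≠ 0 := Complex.two_pi_I_ne_zero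
  set T : ℝ → (H →L[ℂ] H) := fun θ => Complex.exp (θ * Complex.I) • resv A (c.σ θ) with hT
  have hTc : Continuous T := by fun_prop
  have hTpos : ∀ θ y, 0 ≤ (inner ℂ y (T θ y)).re := by
    intro θ y
    set w := resv A (c.σ θ) y with hw
    have hy : y = c.σ θ • w - A w := by
      have := congrArg (fun T : H →L[ℂ] H => T y) (Ring.mul_inverse_cancel _ (c.isUnit hA θ))
      simpa [hw, resv] using this.symm
    have h1 := hA θ w
    have h2 : dirRe θ (inner ℂ w y) = dirRe θ (c.σ θ) * ‖w‖ ^ 2 - dirRe θ (inner ℂ w (A w)) := by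
      rw [hy, inner_sub_right, inner_smul_right, inner_self_eq_norm_sq_to_K]
      have : ((‖w‖ : ℂ)) ^ 2 = ((‖w‖ ^ 2 : ℝ) : ℂ) := by push_cast; rfl
      simp only [dirRe, Complex.sub_re, Complex.sub_im, Complex.coe_algebraMap, this, Complex.re_mul_ofReal, Complex.im_mul_ofReal]
      ring
    have h3 : (inner ℂ y (T θ y)).re = dirRe θ (inner ℂ w y) := by
      rw [hT]
      simp only [_root_.smul_apply]
      rw [inner_smul_right, ← hw, dirRe_exp, ← inner_conj_symm y w]
      simp only [Complex.mul_re, Complex.conj_re, Complex.conj_im]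
      ring
    have := c.hδ
    rw [h3, h2]
    have : 0 ≤ c.δ * ‖w‖ ^ 2 := by positivity
    linarith
  set κ : ℝ → ℝ := fun θ => c.ρ θ / (2 * Real.pi) with hκ
  have hκc : Continuous κ := by fun_prop
  have hκ0 : ∀ θ, 0 ≤ κ θ := fun θ => div_nonneg (c.hρ θ) (by positivity)
  have hone : ∀ u : H, ∫ θ in (0:ℝ)..(2 * Real.pi), κ θ * (inner ℂ u (T θ u)).re = ‖u‖ ^ 2 := by
    intro u
    have h1 := c.cauchy hA 1
    have h2 := c.vec_int hA (f := fun _ => 1) continuous_const u u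
    simp only [eval_one, map_one] at h1
    rw [h1, smul_smul, inv_mul_cancel₀ hπ, one_smul, _root_.one_apply_eq_self,
      inner_self_eq_norm_sq_to_K] at h2
    have h3 := congrArg Complex.re h2
    have h4 : ∀ f : ℝ → ℂ, Continuous f → (∫ θ in (0:ℝ)..(2 * Real.pi), f θ).re = ∫ θ in (0:ℝ)..(2 * Real.pi), (f θ).re :=
      fun f hf => (ContinuousLinearMap.intervalIntegral_comp_comm Complex.reCLM (hf.intervalIntegrable _ _)).symm
    rw [h4 _ (by
      have : Continuous fun θ => inner ℂ u (T θ u) := (vecFun u u).continuous.comp hTc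
      have h5 : Continuous fun θ => ((κ θ : ℝ) : ℂ) := by fun_prop
      exact (continuous_const.mul h5).mul this)] at h3
    have h6 : ((((‖u‖ : ℝ) : ℂ)) ^ 2).re = ‖u‖ ^ 2 := by rw [← Complex.ofReal_pow, Complex.ofReal_re]
    rw [← h6]
    refine Eq.trans ?_ h3.symm
    congr 1
    funext θ
    rw [one_mul, Complex.re_ofReal_mul]
  have hconj : ∀ f : ℝ → ℂ, (starRingEnd ℂ) (∫ θ in (0:ℝ)..(2 * Real.pi), f θ) = ∫ θ in (0:ℝ)..(2 * Real.pi), (starRingEnd ℂ) (f θ) := by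
    intro f
    rw [intervalIntegral.integral_of_le (by positivity), intervalIntegral.integral_of_le (by positivity)]
    exact integral_conj.symm
  have key : ∀ u v : H, ‖inner ℂ u ((aeval A p + star (c.g A p)) v)‖ ≤ M * (‖u‖ ^ 2 + ‖v‖ ^ 2) := by
    intro u v
    have e1 : inner ℂ u (aeval A p v) = ∫ θ in (0:ℝ)..(2 * Real.pi), p.eval (c.σ θ) * (κ θ : ℂ) * inner ℂ u (T θ v) := by
      rw [← c.vec_int hA hpσ, c.cauchy hA p, smul_smul, inv_mul_cancel₀ hπ, one_smul]
    have e2 : inner ℂ u (star (c.g A p) v) = ∫ θ in (0:ℝ)..(2 * Real.pi), p.eval (c.σ θ) * (κ θ : ℂ) * inner ℂ (T θ u) v := by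
      have hpc : Continuous fun θ => (starRingEnd ℂ) (p.eval (c.σ θ)) := Complex.continuous_conj.comp hpσ
      rw [ContinuousLinearMap.star_eq_adjoint, ContinuousLinearMap.adjoint_inner_right, ← inner_conj_symm,
        CurveData.g, c.vec_int hA hpc]
      rw [hconj]
      congr 1
      funext θ
      simp only [map_mul, Complex.conj_conj, Complex.conj_ofReal, inner_conj_symm]
      rfl
    have ci1 : Continuous fun θ => inner ℂ u (T θ v) := (vecFun u v).continuous.comp hTc
    have ci2 : Continuous fun θ => inner ℂ (T θ u) v := by
      have := Complex.continuous_conj.comp ((vecFun v u).continuous.comp hTc)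
      refine this.congr fun θ => ?_
      simp [vecFun_apply]
    have ci3 : ∀ u, Continuous fun θ => (inner ℂ u (T θ u)).re := fun u =>
      Complex.continuous_re.comp ((vecFun u u).continuous.comp hTc)
    have cκ : Continuous fun θ => ((κ θ : ℝ) : ℂ) := by fun_prop
    have e3 : inner ℂ u ((aeval A p + star (c.g A p)) v) = ∫ θ in (0:ℝ)..(2 * Real.pi),
        p.eval (c.σ θ) * (κ θ : ℂ) * (inner ℂ u (T θ v) + inner ℂ (T θ u) v) := by
      rw [_root_.add_apply, inner_add_right, e1, e2, ← intervalIntegral.integral_add]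
      · simp only [mul_add]
      · exact ((hpσ.mul cκ).mul ci1).intervalIntegrable _ _
      · exact ((hpσ.mul cκ).mul ci2).intervalIntegrable _ _
    rw [e3]
    calc _ ≤ ∫ θ in (0:ℝ)..(2 * Real.pi), M * (κ θ * (inner ℂ u (T θ u)).re + κ θ * (inner ℂ v (T θ v)).re) := by
          refine intervalIntegral.norm_integral_le_of_norm_le (by positivity) ?_ ?_
          · refine Filter.Eventually.of_forall fun θ _ => ?_
            rw [norm_mul, norm_mul, Complex.norm_real, Real.norm_of_nonneg (hκ0 θ), ← mul_add, mul_assoc]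
            have h := pos_form (T θ) (hTpos θ) u v
            exact mul_le_mul (hM θ) (mul_le_mul_of_nonneg_left h (hκ0 θ))
              (mul_nonneg (hκ0 θ) (norm_nonneg _)) hM0
          · have h1 := ci3 u
            have h2 := ci3 v
            exact Continuous.intervalIntegrable (by fun_prop) _ _
      _ = M * (‖u‖ ^ 2 + ‖v‖ ^ 2) := by
          rw [intervalIntegral.integral_const_mul, intervalIntegral.integral_add, hone, hone]
          · exact (hκc.mul (ci3 u)).intervalIntegrable _ _
          · exact (hκc.mul (ci3 v)).intervalIntegrable _ _
  refine ContinuousLinearMap.opNorm_le_of_unit_norm (by positivity) fun v hv => ?_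
  set w := (aeval A p + star (c.g A p)) v with hw
  by_cases h0 : w = 0
  · rw [h0, norm_zero]; positivity
  have hn : ‖w‖ ≠ 0 := norm_ne_zero_iff.2 h0
  have h := key (((‖w‖⁻¹ : ℝ) : ℂ) • w) v
  rw [← hw, inner_smul_left, inner_self_eq_norm_sq_to_K, norm_smul, hv] at h
  simp [hn] at h
  rw [pow_two, ← mul_assoc, inv_mul_cancel₀ hn] at h
  linarith

lemma CurveData.finite_bound (c : CurveData) {A : H →L[ℂ] H} (hA : c.Inside A) :
    ∃ C : ℝ, 0 ≤ C ∧ ∀ (p : ℂ[X]) (M : ℝ), (∀ θ, ‖p.eval (c.σ θ)‖ ≤ M) → ‖aeval A p‖ ≤ C * M := by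
  obtain ⟨D, hD⟩ := (isCompact_uIcc (a := (0:ℝ)) (b := 2 * Real.pi)).exists_bound_of_continuousOn c.dσ_cont.continuousOn
  have hD0 : 0 ≤ D := (norm_nonneg _).trans (hD 0 (by simp))
  have hδ := c.hδ
  refine ⟨D * (1 / c.δ), by positivity, fun p M hM => ?_⟩
  have hM0 : 0 ≤ M := (norm_nonneg _).trans (hM 0)
  have h1 := c.cauchy hA p
  have h2 := intervalIntegral.norm_integral_le_of_norm_le_const (a := 0) (b := 2 * Real.pi)
    (f := fun θ => (p.eval (c.σ θ) * c.dσ θ) • resv A (c.σ θ)) (C := M * D * (1 / c.δ)) (fun θ hθ => by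
      rw [norm_smul, norm_mul]
      refine mul_le_mul ?_ (c.res_norm hA θ) (norm_nonneg _) (by positivity)
      exact mul_le_mul (hM θ) (hD θ (Set.uIoc_subset_uIcc hθ)) (norm_nonneg _) hM0)
  rw [h1, norm_smul, sub_zero, abs_of_pos (by positivity)] at h2
  have : ‖(2 * Real.pi * Complex.I : ℂ)‖ = 2 * Real.pi := by
    simp [abs_of_pos Real.pi_pos]
  rw [this] at h2
  have hp : 0 < 2 * Real.pi := by positivity
  nlinarith
end op3
/-! ### Part 4: approximation by polynomials and the sharp bound -/
section op4

lemma map_resv {𝔸 𝔹 : Type*} [Ring 𝔸] [Algebra ℂ 𝔸] [Ring 𝔹] [Algebra ℂ 𝔹] (φ : 𝔹 →ₐ[ℂ] 𝔸) {x : 𝔹} {s : ℂ}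
    (h : IsUnit (s • (1:𝔹) - x)) : φ (resv x s) = resv (φ x) s := by
  obtain ⟨u, hu⟩ := h
  have h2 : s • (1:𝔸) - φ x = (Units.map (φ : 𝔹 →* 𝔸) u : 𝔸ˣ) := by
    rw [Units.coe_map, hu]; simp
  rw [resv, resv, h2, ← hu, Ring.inverse_unit, Ring.inverse_unit, ← map_inv, Units.coe_map]
  rfl

lemma CurveData.res_cont' (c : CurveData) {𝔹 : Type*} [NormedRing 𝔹] [NormedAlgebra ℂ 𝔹] [CompleteSpace 𝔹] {x : 𝔹}
    (h : ∀ θ, IsUnit (c.σ θ • (1:𝔹) - x)) : Continuous fun θ => resv x (c.σ θ) := by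
  rw [continuous_iff_continuousAt]
  intro θ
  obtain ⟨u, hu⟩ := h θ
  have h1 := NormedRing.inverse_continuousAt u
  rw [hu] at h1
  have hσ := c.σ_cont
  have h2 : Continuous fun θ => c.σ θ • (1:𝔹) - x := by fun_prop
  exact ContinuousAt.comp (f := fun θ => c.σ θ • (1:𝔹) - x) h1 h2.continuousAt

lemma CurveData.map_g (c : CurveData) {𝔸 𝔹 : Type*} [NormedRing 𝔸] [NormedAlgebra ℂ 𝔸] [CompleteSpace 𝔸]
    [NormedRing 𝔹] [NormedAlgebra ℂ 𝔹] [CompleteSpace 𝔹] (φ : 𝔹 →ₐ[ℂ] 𝔸) (hφ : Continuous φ) {x : 𝔹}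
    (h : ∀ θ, IsUnit (c.σ θ • (1:𝔹) - x)) (p : ℂ[X]) : φ (c.g x p) = c.g (φ x) p := by
  have hc := c.res_cont' h
  have hd := c.dσ_cont
  have hpc : Continuous fun θ => (starRingEnd ℂ) (p.eval (c.σ θ)) :=
    Complex.continuous_conj.comp (p.continuous.comp c.σ_cont)
  let ψ : 𝔹 →L[ℂ] 𝔸 := ⟨φ.toLinearMap, hφ⟩
  have e : ∀ y, φ y = ψ y := fun _ => rfl
  unfold CurveData.g
  rw [map_smul, e, ← ContinuousLinearMap.intervalIntegral_comp_comm]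
  · congr 2
    funext θ
    rw [map_smul, ← e, map_resv φ (h θ)]
  · exact Continuous.intervalIntegrable (by fun_prop) _ _

variable {H : Type*} [NormedAddCommGroup H] [InnerProductSpace ℂ H] [CompleteSpace H]

lemma CurveData.scalar_inside (c : CurveData) {F : Set ℂ} {R : ℝ} (hR : ∀ z ∈ F, ‖z‖ ≤ R)
    (hc : ∀ θ, suppFun F θ + c.δ ≤ dirRe θ (c.σ θ)) {z : ℂ} (hz : z ∈ F) :
    c.Inside (z • (1 : ℂ →L[ℂ] ℂ)) := by
  intro θ y
  have h1 := le_supp hR θ hz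
  have h2 := hc θ
  have h3 : inner ℂ y ((z • (1 : ℂ →L[ℂ] ℂ)) y) = z * ((‖y‖ ^ 2 : ℝ) : ℂ) := by
    rw [_root_.smul_apply, inner_smul_right, _root_.one_apply_eq_self, inner_self_eq_norm_sq_to_K]
    push_cast; rfl
  have h4 : dirRe θ (z * ((‖y‖ ^ 2 : ℝ) : ℂ)) = dirRe θ z * ‖y‖ ^ 2 := by
    simp only [dirRe, Complex.re_mul_ofReal, Complex.im_mul_ofReal]; ring
  rw [h3, h4]
  have : 0 ≤ ‖y‖ ^ 2 := by positivity
  nlinarith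

lemma CurveData.scalar_bound (c : CurveData) {F : Set ℂ} {R : ℝ} (hR : ∀ z ∈ F, ‖z‖ ≤ R)
    (hc : ∀ θ, suppFun F θ + c.δ ≤ dirRe θ (c.σ θ)) {z : ℂ} (hz : z ∈ F) (p : ℂ[X]) {M : ℝ}
    (hM : ∀ θ, ‖p.eval (c.σ θ)‖ ≤ M) : ‖c.g z p‖ ≤ 2 * M + ‖p.eval z‖ := by
  have hin := c.scalar_inside hR hc hz
  have h1 := c.S_bound hin p hM
  have hu : ∀ θ, IsUnit (c.σ θ • (1:ℂ) - z) := by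
    intro θ
    rw [isUnit_iff_ne_zero]
    intro h
    have h2 := le_supp hR θ hz
    have h3 := hc θ
    have h4 := c.hδ
    have : c.σ θ = z := by
      rw [smul_eq_mul, mul_one] at h; exact sub_eq_zero.1 h
    rw [this] at h3
    linarith
  have h2 := c.map_g (Algebra.ofId ℂ (ℂ →L[ℂ] ℂ)) (continuous_algebraMap ℂ (ℂ →L[ℂ] ℂ)) hu p
  have e : ∀ w : ℂ, Algebra.ofId ℂ (ℂ →L[ℂ] ℂ) w = w • (1 : ℂ →L[ℂ] ℂ) := fun w => by
    rw [Algebra.ofId_apply, Algebra.algebraMap_eq_smul_one]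
  rw [e, e] at h2
  have h3 : aeval (z • (1 : ℂ →L[ℂ] ℂ)) p = p.eval z • (1 : ℂ →L[ℂ] ℂ) := by
    rw [← e, ← e, Polynomial.aeval_algHom_apply]
    simp
  have h5 : ‖c.g z p‖ = ‖star (c.g (z • (1 : ℂ →L[ℂ] ℂ)) p)‖ := by
    rw [ContinuousLinearMap.star_eq_adjoint, LinearIsometryEquiv.norm_map, ← h2, norm_smul, norm_one, mul_one]
  have h6 : ‖p.eval z‖ = ‖aeval (z • (1 : ℂ →L[ℂ] ℂ)) p‖ := by
    rw [h3, norm_smul, norm_one, mul_one]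
  rw [h5, h6]
  have := norm_sub_le (aeval (z • (1 : ℂ →L[ℂ] ℂ)) p + star (c.g (z • (1 : ℂ →L[ℂ] ℂ)) p)) (aeval (z • (1 : ℂ →L[ℂ] ℂ)) p)
  rw [add_sub_cancel_left] at this
  linarith

lemma CurveData.g_approx (c : CurveData) {F : Set ℂ} (hF : IsCompact F) (h0 : (0:ℂ) ∈ F)
    (hc : ∀ θ, suppFun F θ + c.δ ≤ dirRe θ (c.σ θ)) {A : H →L[ℂ] H} (hA : c.Inside A) (p : ℂ[X]) {e : ℝ}
    (he : 0 < e) : ∃ q : ℂ[X], ‖aeval A q - c.g A p‖ ≤ e ∧ ∀ z ∈ F, ‖q.eval z - c.g z p‖ ≤ e := by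
  have : CompactSpace F := isCompact_iff_compactSpace.1 hF
  have : Nonempty F := ⟨⟨0, h0⟩⟩
  obtain ⟨R, hR⟩ := hF.isBounded.exists_norm_le
  let Y : C(F, ℂ) × (H →L[ℂ] H) := (⟨fun z => (z : ℂ), continuous_subtype_val⟩, A)
  let x : Algebra.elemental ℂ Y := ⟨Y, Algebra.elemental.self_mem ℂ Y⟩
  have hδ := c.hδ
  have hu : ∀ θ, IsUnit (c.σ θ • (1:Algebra.elemental ℂ Y) - x) := by
    intro θ
    have hX : ‖x‖ = ‖Y‖ := rfl
    have hs0 : 0 ≤ (‖Y‖ ^ 2 + 1) / (2 * c.δ) := by positivity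
    have hs1 : ‖Y‖ ^ 2 < 2 * ((‖Y‖ ^ 2 + 1) / (2 * c.δ)) * c.δ := by
      field_simp; linarith
    generalize (‖Y‖ ^ 2 + 1) / (2 * c.δ) = s at hs0 hs1
    apply isUnit_of_far x (c.σ θ) (-(s : ℂ) * Complex.exp (θ * Complex.I))
    have h1 : ‖A‖ ≤ ‖Y‖ := norm_snd_le Y
    have h2 : ∀ z ∈ F, ‖z‖ ≤ ‖Y‖ := fun z hz =>
      (ContinuousMap.norm_coe_le_norm Y.1 ⟨z, hz⟩).trans (norm_fst_le Y)
    have k1 := c.far hA θ hs0 (by nlinarith [norm_nonneg A])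
    have k2 : ∀ z ∈ F, ‖z - (-(s : ℂ) * Complex.exp (θ * Complex.I))‖ <
        ‖c.σ θ - (-(s : ℂ) * Complex.exp (θ * Complex.I))‖ := by
      intro z hz
      have k3 := c.far (c.scalar_inside hR hc hz) θ hs0 (by
        rw [norm_smul, norm_one, mul_one]; nlinarith [norm_nonneg z, h2 z hz])
      rw [← sub_smul, norm_smul, norm_one, mul_one] at k3
      exact k3
    have k4 : ‖x - (-(s : ℂ) * Complex.exp (θ * Complex.I)) • (1:Algebra.elemental ℂ Y)‖
        = ‖Y - (-(s : ℂ) * Complex.exp (θ * Complex.I)) • (1 : C(F, ℂ) × (H →L[ℂ] H))‖ := rfl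
    rw [k4, Prod.norm_def, max_lt_iff]
    refine ⟨?_, k1⟩
    rw [ContinuousMap.norm_lt_iff_of_nonempty]
    intro z
    have := k2 z z.2
    simpa [Y] using this
  set G : Algebra.elemental ℂ Y := c.g x p with hG
  have hmem : (G : C(F, ℂ) × (H →L[ℂ] H)) ∈ closure (Algebra.adjoin ℂ {Y} : Set (C(F, ℂ) × (H →L[ℂ] H))) := G.2
  obtain ⟨b, hb, hbd⟩ := Metric.mem_closure_iff.1 hmem e he
  rw [SetLike.mem_coe, Algebra.adjoin_singleton_eq_range_aeval] at hb
  obtain ⟨q, rfl⟩ := hb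
  rw [dist_comm, dist_eq_norm] at hbd
  refine ⟨q, ?_, fun z hz => ?_⟩
  · have h1 := c.map_g ((AlgHom.snd ℂ C(F, ℂ) (H →L[ℂ] H)).comp (Algebra.elemental ℂ Y).val)
      (continuous_snd.comp continuous_subtype_val) hu p
    have h2 : aeval A q = AlgHom.snd ℂ C(F, ℂ) (H →L[ℂ] H) (aeval Y q) := by
      rw [← Polynomial.aeval_algHom_apply]; rfl
    have h3 : c.g A p = AlgHom.snd ℂ C(F, ℂ) (H →L[ℂ] H) (G : C(F, ℂ) × (H →L[ℂ] H)) := h1.symm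
    rw [h2, h3, ← map_sub]
    exact (norm_snd_le _).trans hbd.le
  · let φ : C(F, ℂ) × (H →L[ℂ] H) →ₐ[ℂ] ℂ := (ContinuousMap.evalAlgHom ℂ ℂ (⟨z, hz⟩ : F)).comp (AlgHom.fst ℂ C(F, ℂ) (H →L[ℂ] H))
    have hφ : Continuous φ := (continuous_eval_const (⟨z, hz⟩ : F)).comp continuous_fst
    have h1 := c.map_g (φ.comp (Algebra.elemental ℂ Y).val)
      (hφ.comp continuous_subtype_val) hu p
    have h2 : q.eval z = φ (aeval Y q) := by
      rw [← Polynomial.aeval_algHom_apply, ← Polynomial.coe_aeval_eq_eval]; rfl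
    have h3 : c.g z p = φ (G : C(F, ℂ) × (H →L[ℂ] H)) := h1.symm
    rw [h2, h3, ← map_sub]
    exact ((ContinuousMap.norm_coe_le_norm _ (⟨z, hz⟩ : F)).trans (norm_fst_le _)).trans hbd.le

/-- `C` is a spectral constant of `F` for `A`. -/
def Works (F : Set ℂ) (A : H →L[ℂ] H) (C : ℝ) : Prop :=
  ∀ (p : ℂ[X]) (M : ℝ), (∀ z ∈ F, ‖p.eval z‖ ≤ M) → ‖aeval A p‖ ≤ C * M

lemma thick_bound {F : Set ℂ} (hF : IsCompact F) (p : ℂ[X]) {M e : ℝ} (he : 0 < e)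
    (h : ∀ z ∈ F, ‖p.eval z‖ ≤ M) : ∃ η, 0 < η ∧ ∀ z ∈ Metric.cthickening η F, ‖p.eval z‖ ≤ M + e := by
  have ho : IsOpen {z : ℂ | ‖p.eval z‖ < M + e} := isOpen_lt p.continuous.norm continuous_const
  obtain ⟨η, h1, h2⟩ := hF.exists_cthickening_subset_open ho (fun z hz => by
    have := h z hz
    simp only [Set.mem_ofPred_eq]; linarith)
  exact ⟨η, h1, fun z hz => (h2 hz).le⟩

lemma norm_four (a : H →L[ℂ] H) : ‖a * star a * (a * star a)‖ = ‖a‖ ^ 4 := by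
  have h1 : ‖a * star a‖ = ‖a‖ * ‖a‖ := CStarRing.norm_self_mul_star
  have h2 : ‖star (a * star a) * (a * star a)‖ = ‖a * star a‖ * ‖a * star a‖ := CStarRing.norm_star_mul_self
  rw [star_mul, star_star] at h2
  rw [h2, h1]; ring

lemma step_ineq {F : Set ℂ} (hF : IsCompact F) (hcv : Convex ℝ F) (h0 : (0:ℂ) ∈ F) {A : H →L[ℂ] H}
    (hnum : ∀ θ y, dirRe θ (inner ℂ y (A y)) ≤ suppFun F θ * ‖y‖ ^ 2) {C : ℝ} (hC : 0 ≤ C) (hW : Works F A C)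
    (p : ℂ[X]) (hp : ∀ z ∈ F, ‖p.eval z‖ ≤ 1) {e : ℝ} (he : 0 < e) :
    ‖aeval A p‖ ^ 4 ≤ 2 * (1 + e) * ‖aeval A p‖ ^ 3 + (C * (3 + 3 * e) + e * ‖aeval A p‖ ^ 2) * ‖aeval A p‖ := by
  obtain ⟨R, hR⟩ := hF.isBounded.exists_norm_le
  obtain ⟨η, hη, hpη⟩ := thick_bound hF p he hp
  obtain ⟨c, hc1, hc2⟩ := exists_curve hF hcv h0 hη
  have hA : c.Inside A := fun θ y => by
    have h1 := hnum θ y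
    have h2 := hc2 θ
    have : 0 ≤ ‖y‖ ^ 2 := by positivity
    nlinarith
  have hM : ∀ θ, ‖p.eval (c.σ θ)‖ ≤ 1 + e := fun θ => hpη _ (hc1 θ)
  obtain ⟨q, hq1, hq2⟩ := c.g_approx hF h0 hc2 hA p he
  have hS := c.S_bound hA p hM
  set a := aeval A p with ha
  set G := c.g A p with hG
  have hqb : ∀ z ∈ F, ‖(p * q * p).eval z‖ ≤ 3 + 3 * e := by
    intro z hz
    have h1 := hp z hz
    have h2 := hq2 z hz
    have h3 := c.scalar_bound hR hc2 hz p hM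
    have h4 : ‖q.eval z‖ ≤ 3 + 3 * e := by
      have := norm_add_le (q.eval z - c.g z p) (c.g z p)
      rw [sub_add_cancel] at this
      linarith
    rw [eval_mul, eval_mul, norm_mul, norm_mul]
    have h5 := norm_nonneg (p.eval z)
    have h6 := norm_nonneg (q.eval z)
    calc _ ≤ 1 * (3 + 3 * e) * 1 := by gcongr
      _ = _ := by ring
  have h1 := hW (p * q * p) _ hqb
  rw [map_mul, map_mul, ← ha] at h1
  have h2 : ‖a * G * a‖ ≤ C * (3 + 3 * e) + e * ‖a‖ ^ 2 := by
    have e1 : a * G * a = a * aeval A q * a - a * (aeval A q - G) * a := by noncomm_ring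
    rw [e1]
    refine (norm_sub_le _ _).trans (add_le_add h1 ?_)
    calc _ ≤ ‖a‖ * ‖aeval A q - G‖ * ‖a‖ := (norm_mul_le _ _).trans (by gcongr; exact norm_mul_le _ _)
      _ ≤ ‖a‖ * e * ‖a‖ := by gcongr
      _ = _ := by ring
  have hsa : ‖star a‖ = ‖a‖ := norm_star a
  have hsS : ‖star (a + star G)‖ ≤ 2 * (1 + e) := by rw [norm_star]; exact hS
  have e2 : a * star a * (a * star a) = a * star (a + star G) * (a * star a) - a * G * a * star a := by
    rw [star_add, star_star]; noncomm_ring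
  rw [← norm_four, e2]
  refine (norm_sub_le _ _).trans (add_le_add ?_ ?_)
  · calc _ ≤ ‖a‖ * ‖star (a + star G)‖ * (‖a‖ * ‖star a‖) := (norm_mul_le _ _).trans (by
          gcongr
          · exact norm_mul_le _ _
          · exact norm_mul_le _ _)
      _ ≤ ‖a‖ * (2 * (1 + e)) * (‖a‖ * ‖a‖) := by rw [hsa]; gcongr
      _ = _ := by ring
  · calc _ ≤ ‖a * G * a‖ * ‖star a‖ := norm_mul_le _ _
      _ ≤ _ := by rw [hsa]; gcongr

lemma Works.of_one {F : Set ℂ} (h0 : (0:ℂ) ∈ F) {A : H →L[ℂ] H} {C : ℝ} (hC : 0 ≤ C)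
    (h : ∀ p : ℂ[X], (∀ z ∈ F, ‖p.eval z‖ ≤ 1) → ‖aeval A p‖ ≤ C) : Works F A C := by
  intro p M hM
  have hM0 : 0 ≤ M := (norm_nonneg _).trans (hM 0 h0)
  refine le_of_forall_pos_le_add fun e he => ?_
  have hx : 0 < e / (C + 1) := by positivity
  set m := M + e / (C + 1) with hm
  have hm0 : 0 < m := by positivity
  have h1 := h (Polynomial.C ((m:ℂ)⁻¹) * p) (fun z hz => by
    rw [eval_mul, eval_C, norm_mul, norm_inv, Complex.norm_real, Real.norm_of_nonneg hm0.le, inv_mul_le_iff₀ hm0]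
    have := hM z hz
    linarith)
  rw [map_mul, aeval_C, ← Algebra.smul_def, norm_smul, norm_inv, Complex.norm_real, Real.norm_of_nonneg hm0.le,
    inv_mul_le_iff₀ hm0] at h1
  have h2 : C * (e / (C + 1)) ≤ e := by
    rw [mul_div_assoc', div_le_iff₀ (by positivity)]; nlinarith
  calc _ ≤ m * C := h1
    _ = C * M + C * (e / (C + 1)) := by rw [hm]; ring
    _ ≤ _ := by linarith

lemma Works.step {F : Set ℂ} (hF : IsCompact F) (hcv : Convex ℝ F) (h0 : (0:ℂ) ∈ F) {A : H →L[ℂ] H}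
    (hnum : ∀ θ y, dirRe θ (inner ℂ y (A y)) ≤ suppFun F θ * ‖y‖ ^ 2) {D : ℝ} (hD : 0 ≤ D)
    (hW : Works F A (3 + D)) : Works F A (3 + D / 3) := by
  refine Works.of_one h0 (by positivity) fun p hp => ?_
  set x := ‖aeval A p‖ with hx
  have hx0 : 0 ≤ x := norm_nonneg _
  have h1 : x ^ 4 ≤ 2 * x ^ 3 + 3 * (3 + D) * x := by
    refine le_of_forall_pos_le_add fun e he => ?_
    set k := 3 * x ^ 3 + 3 * (3 + D) * x with hk
    have hk0 : 0 ≤ k := by positivity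
    have hy : 0 < e / (k + 1) := by positivity
    have h := step_ineq hF hcv h0 hnum (by positivity) hW p hp hy
    rw [← hx] at h
    have h2 : k * (e / (k + 1)) ≤ e := by
      rw [mul_div_assoc', div_le_iff₀ (by positivity)]; nlinarith
    generalize e / (k + 1) = d at h h2 hy
    rw [hk] at h2
    nlinarith
  by_contra hcon
  push Not at hcon
  have h3 : 3 < x := by linarith
  have h4 : x ^ 3 ≤ 2 * x ^ 2 + 3 * (3 + D) := by
    refine le_of_mul_le_mul_right ?_ (show 0 < x by linarith)
    nlinarith
  have h5 : 9 * (x - 2) ≤ x ^ 2 * (x - 2) := by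
    apply mul_le_mul_of_nonneg_right _ (by linarith)
    nlinarith
  nlinarith

lemma Works.three_of {F : Set ℂ} (hF : IsCompact F) (hcv : Convex ℝ F) (h0 : (0:ℂ) ∈ F) {A : H →L[ℂ] H}
    (hnum : ∀ θ y, dirRe θ (inner ℂ y (A y)) ≤ suppFun F θ * ‖y‖ ^ 2) {D : ℝ} (hD : 0 ≤ D)
    (hW : Works F A (3 + D)) : Works F A 3 := by
  have h : ∀ n : ℕ, Works F A (3 + D * (1 / 3) ^ n) := by
    intro n
    induction n with
    | zero => simpa using hW
    | succ n ih =>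
      have := Works.step hF hcv h0 hnum (by positivity) ih
      convert this using 2
      ring
  intro p M hM
  have h1 : Filter.Tendsto (fun n : ℕ => (3 + D * (1 / 3 : ℝ) ^ n) * M) Filter.atTop (nhds ((3 + D * 0) * M)) :=
    ((tendsto_pow_atTop_nhds_zero_of_lt_one (by norm_num) (by norm_num)).const_mul D |>.const_add 3).mul_const M
  rw [mul_zero, add_zero] at h1
  exact ge_of_tendsto' h1 fun n => h n p M hM

lemma works_zero {E : Set ℂ} (hE : IsCompact E) (hcv : Convex ℝ E) (h0 : (0:ℂ) ∈ E) {A : H →L[ℂ] H}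
    (hnum : ∀ θ y, dirRe θ (inner ℂ y (A y)) ≤ suppFun E θ * ‖y‖ ^ 2) : Works E A 3 := by
  have key : ∀ η > 0, Works (Metric.cthickening η E) A 3 := by
    intro η hη
    have hsub : E ⊆ Metric.cthickening η E := Metric.self_subset_cthickening E
    have hF : IsCompact (Metric.cthickening η E) := hE.cthickening
    obtain ⟨R, hR⟩ := hF.isBounded.exists_norm_le
    obtain ⟨c, hc1, hc2⟩ := exists_curve hE hcv h0 hη
    have hA : c.Inside A := fun θ y => by
      have h1 := hnum θ y
      have h2 := hc2 θ
      have : 0 ≤ ‖y‖ ^ 2 := by positivity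
      nlinarith
    obtain ⟨C, hC0, hC⟩ := c.finite_bound hA
    refine Works.three_of hF (hcv.cthickening η) (hsub h0) (fun θ y => ?_) hC0 (fun p M hM => ?_)
    · refine (hnum θ y).trans ?_
      gcongr
      exact supp_le ⟨0, h0⟩ θ fun z hz => le_supp hR θ (hsub hz)
    · have h1 := hC p M fun θ => hM _ (hc1 θ)
      have hM0 : 0 ≤ M := (norm_nonneg _).trans (hM 0 (hsub h0))
      linarith
  intro p M hM
  refine le_of_forall_pos_le_add fun e he => ?_
  obtain ⟨η, hη, h⟩ := thick_bound hE p (show 0 < e / 3 by positivity) hM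
  have := key η hη p _ h
  linarith

/-- Translation: no need for `0 ∈ E`. -/
lemma works_three {E : Set ℂ} (hE : IsCompact E) (hcv : Convex ℝ E) (hne : E.Nonempty) {A : H →L[ℂ] H}
    (hnum : ∀ θ y, dirRe θ (inner ℂ y (A y)) ≤ suppFun E θ * ‖y‖ ^ 2) : Works E A 3 := by
  obtain ⟨w, hw⟩ := hne
  set E' : Set ℂ := (fun z => z - w) '' E with hE'
  have h1 : IsCompact E' := hE.image (by fun_prop)
  have h2 : Convex ℝ E' := by
    have e : E' = (fun x => -w + x) '' E := by
      rw [hE']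
      congr 1
      funext z
      ring
    rw [e]
    exact hcv.translate (-w)
  have h3 : (0:ℂ) ∈ E' := ⟨w, hw, by simp⟩
  obtain ⟨R, hR⟩ := h1.isBounded.exists_norm_le
  have h4 := works_zero h1 h2 h3 (A := A - w • (1 : H →L[ℂ] H)) (fun θ y => by
    have e1 : inner ℂ y ((A - w • (1 : H →L[ℂ] H)) y) = inner ℂ y (A y) - w * ((‖y‖ ^ 2 : ℝ) : ℂ) := by
      rw [_root_.sub_apply, inner_sub_right, _root_.smul_apply, inner_smul_right, _root_.one_apply_eq_self,
        inner_self_eq_norm_sq_to_K]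
      push_cast; rfl
    have e2 : dirRe θ (inner ℂ y (A y) - w * ((‖y‖ ^ 2 : ℝ) : ℂ)) = dirRe θ (inner ℂ y (A y)) - dirRe θ w * ‖y‖ ^ 2 := by
      simp only [dirRe, Complex.sub_re, Complex.sub_im, Complex.re_mul_ofReal, Complex.im_mul_ofReal]; ring
    have e3 : suppFun E θ ≤ suppFun E' θ + dirRe θ w := by
      refine supp_le ⟨w, hw⟩ θ fun z hz => ?_
      have := le_supp hR θ (show z - w ∈ E' from ⟨z, hz, rfl⟩)
      simp only [dirRe, Complex.sub_re, Complex.sub_im] at this ⊢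
      linarith
    have e4 := hnum θ y
    have : 0 ≤ ‖y‖ ^ 2 := by positivity
    rw [e1, e2]
    nlinarith)
  intro p M hM
  have h5 := h4 (p.comp (X + C w)) M (by
    rintro _ ⟨z, hz, rfl⟩
    simpa using hM z hz)
  rw [aeval_comp] at h5
  have e : aeval (A - w • (1 : H →L[ℂ] H)) (X + C w) = A := by
    rw [map_add, aeval_X, aeval_C, Algebra.algebraMap_eq_smul_one, sub_add_cancel]
  rwa [e] at h5
end op4
/-! ### Part 5: the application to block triangular matrices -/
section rec5
variable {𝔸 : Type*} [NormedRing 𝔸] [NormedAlgebra ℂ 𝔸] [CompleteSpace 𝔸]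

/-- The segment from `R` to `L`. -/
noncomputable def seg (L R : 𝔸) (t : ℝ) : 𝔸 := R + (t : ℂ) • (L - R)

lemma seg_cont (L R : 𝔸) : Continuous (seg L R) := by
  unfold seg; fun_prop

lemma seg_deriv (L R : 𝔸) (t : ℝ) : HasDerivAt (seg L R) (L - R) t := by
  have h : HasDerivAt (fun t : ℝ => (t : ℂ)) 1 t := Complex.ofRealCLM.hasDerivAt
  have := (h.smul_const (L - R)).const_add R
  rw [one_smul] at this
  exact this

lemma seg_comm {L R : 𝔸} (h : Commute L R) (t : ℝ) : Commute (seg L R t) (L - R) := by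
  unfold seg
  have h1 : Commute R (L - R) := h.symm.sub_right (Commute.refl R)
  exact h1.add_left ((Commute.refl (L - R)).smul_left _)

lemma seg_pow_deriv {L R : 𝔸} (h : Commute L R) (n : ℕ) (t : ℝ) :
    HasDerivAt (fun t => seg L R t ^ n) ((n : ℂ) • ((L - R) * seg L R t ^ (n - 1))) t := by
  induction n with
  | zero => simpa using hasDerivAt_const t (1:𝔸)
  | succ n ih =>
    have h1 := ih.mul (seg_deriv L R t)
    have e : (fun t => seg L R t ^ (n + 1)) = (fun t => seg L R t ^ n) * seg L R := by
      funext t; rw [pow_succ]; rfl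
    rw [e]
    convert h1 using 1
    have hc := (seg_comm h t).symm.pow_right n
    rw [Nat.add_sub_cancel, ← hc.eq]
    rcases n with _ | n
    · simp
    · rw [Nat.add_sub_cancel, smul_mul_assoc, mul_assoc, ← pow_succ]
      push_cast
      rw [add_smul _ (1:ℂ), one_smul]

lemma seg_rec {L R : 𝔸} (h : Commute L R) (n : ℕ) :
    ∫ t in (0:ℝ)..1, ((n + 1 : ℕ) : ℂ) • seg L R t ^ n
      = L * (∫ t in (0:ℝ)..1, (n : ℂ) • seg L R t ^ (n - 1)) + R ^ n := by
  have hs := seg_cont L R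
  have hd : ∀ t ∈ Set.uIcc (0:ℝ) 1, HasDerivAt (fun t : ℝ => ((1 - t : ℝ) : ℂ) • seg L R t ^ n)
      (L * ((n : ℂ) • seg L R t ^ (n - 1)) - ((n + 1 : ℕ) : ℂ) • seg L R t ^ n) t := by
    intro t _
    have h1 : HasDerivAt (fun t : ℝ => ((1 - t : ℝ) : ℂ)) (-1) t := by
      have : HasDerivAt (fun t : ℝ => (t : ℂ)) 1 t := Complex.ofRealCLM.hasDerivAt
      have h2 := this.const_sub 1
      simpa using h2
    have h2 := h1.smul (seg_pow_deriv h n t)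
    refine h2.congr_deriv ?_
    rcases n with _ | n
    · simp
    · have e1 : L = seg L R t + ((1 - t : ℝ) : ℂ) • (L - R) := by
        unfold seg
        push_cast
        rw [sub_smul, one_smul]; abel
      rw [Nat.add_sub_cancel]
      set S := seg L R t
      have e2 : L * (((n + 1 : ℕ) : ℂ) • S ^ n) = ((n + 1 : ℕ) : ℂ) • S ^ (n + 1) +
          ((1 - t : ℝ) : ℂ) • (((n + 1 : ℕ) : ℂ) • ((L - R) * S ^ n)) := by
        conv_lhs => rw [e1]
        rw [add_mul, mul_smul_comm, ← pow_succ', smul_mul_assoc, mul_smul_comm]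
      rw [e2]
      push_cast
      module
  have hftc := intervalIntegral.integral_eq_sub_of_hasDerivAt hd
    (Continuous.intervalIntegrable (by fun_prop) _ _)
  rw [intervalIntegral.integral_sub (Continuous.intervalIntegrable (by fun_prop) _ _)
    (Continuous.intervalIntegrable (by fun_prop) _ _)] at hftc
  have e3 : ∫ t in (0:ℝ)..1, L * ((n : ℂ) • seg L R t ^ (n - 1)) = L * ∫ t in (0:ℝ)..1, ((n : ℂ) • seg L R t ^ (n - 1)) := by
    have := ContinuousLinearMap.intervalIntegral_comp_comm (μ := MeasureTheory.volume) (a := 0) (b := 1)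
      (ContinuousLinearMap.mul ℂ 𝔸 L)
      (f := fun t => (n : ℂ) • seg L R t ^ (n - 1)) (Continuous.intervalIntegrable (by fun_prop) _ _)
    simpa using this
  rw [e3] at hftc
  have e4 : seg L R 0 = R := by simp [seg]
  rw [e4] at hftc
  simp only [sub_self, Complex.ofReal_zero, zero_smul, sub_zero, Complex.ofReal_one, one_smul, zero_sub] at hftc
  rw [sub_eq_iff_eq_add] at hftc
  rw [hftc]; abel

/-- The divided-difference operator. -/
noncomputable def divDiff (L R : 𝔸) (p : ℂ[X]) : 𝔸 := ∫ t in (0:ℝ)..1, aeval (seg L R t) (derivative p)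

lemma seg_aeval_cont (L R : 𝔸) (p : ℂ[X]) : Continuous fun t => aeval (seg L R t) p :=
  (Polynomial.continuous_aeval p).comp (seg_cont L R)

lemma divDiff_add (L R : 𝔸) (p q : ℂ[X]) : divDiff L R (p + q) = divDiff L R p + divDiff L R q := by
  unfold divDiff
  rw [← intervalIntegral.integral_add ((seg_aeval_cont L R _).intervalIntegrable _ _)
    ((seg_aeval_cont L R _).intervalIntegrable _ _)]
  simp

lemma divDiff_monomial (L R : 𝔸) (n : ℕ) (a : ℂ) :
    divDiff L R (monomial n a) = a • ∫ t in (0:ℝ)..1, (n : ℂ) • seg L R t ^ (n - 1) := by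
  unfold divDiff
  rw [← intervalIntegral.integral_smul]
  congr 1
  funext t
  rw [derivative_monomial, aeval_monomial, ← Algebra.smul_def, smul_smul]
end rec5

section app5
variable {k l : ℕ}

/-- Vectorization. -/
noncomputable def vecM : Matrix (Fin k) (Fin l) ℂ ≃ₗ[ℂ] EuclideanSpace ℂ (Fin k × Fin l) where
  toFun M := WithLp.toLp 2 fun ij => M ij.1 ij.2
  invFun v := Matrix.of fun i j => v (i, j)
  left_inv M := rfl
  right_inv v := rfl
  map_add' M N := rfl
  map_smul' a M := rfl

lemma vecM_apply (M : Matrix (Fin k) (Fin l) ℂ) (ij : Fin k × Fin l) : vecM M ij = M ij.1 ij.2 := rfl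

lemma vecM_norm (M : Matrix (Fin k) (Fin l) ℂ) : ‖vecM M‖ = frobNorm M := by
  rw [EuclideanSpace.norm_eq, frobNorm, Fintype.sum_prod_type]
  rfl

/-- Left multiplication. -/
noncomputable def lmul (B : Matrix (Fin k) (Fin k) ℂ) :
    EuclideanSpace ℂ (Fin k × Fin l) →L[ℂ] EuclideanSpace ℂ (Fin k × Fin l) :=
  LinearMap.toContinuousLinearMap
    { toFun := fun v => vecM (B * vecM.symm v)
      map_add' := fun v w => by rw [map_add, Matrix.mul_add, map_add]
      map_smul' := fun a v => by rw [map_smul, Matrix.mul_smul, map_smul]; rfl }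

/-- Right multiplication. -/
noncomputable def rmul (B : Matrix (Fin l) (Fin l) ℂ) :
    EuclideanSpace ℂ (Fin k × Fin l) →L[ℂ] EuclideanSpace ℂ (Fin k × Fin l) :=
  LinearMap.toContinuousLinearMap
    { toFun := fun v => vecM (vecM.symm v * B)
      map_add' := fun v w => by rw [map_add, Matrix.add_mul, map_add]
      map_smul' := fun a v => by rw [map_smul, Matrix.smul_mul, map_smul]; rfl }

lemma lmul_vec (B : Matrix (Fin k) (Fin k) ℂ) (M : Matrix (Fin k) (Fin l) ℂ) : lmul B (vecM M) = vecM (B * M) := by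
  change vecM (B * vecM.symm (vecM M)) = _
  rw [LinearEquiv.symm_apply_apply]

lemma rmul_vec (B : Matrix (Fin l) (Fin l) ℂ) (M : Matrix (Fin k) (Fin l) ℂ) : rmul B (vecM M) = vecM (M * B) := by
  change vecM (vecM.symm (vecM M) * B) = _
  rw [LinearEquiv.symm_apply_apply]

lemma lr_comm (B : Matrix (Fin k) (Fin k) ℂ) (D : Matrix (Fin l) (Fin l) ℂ) : Commute (lmul (l := l) B) (rmul (k := k) D) := by
  apply ContinuousLinearMap.ext
  intro v
  obtain ⟨M, rfl⟩ := vecM.surjective v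
  change lmul B (rmul D (vecM M)) = rmul D (lmul B (vecM M))
  rw [lmul_vec, rmul_vec, rmul_vec, lmul_vec, Matrix.mul_assoc]

lemma rmul_pow (D : Matrix (Fin l) (Fin l) ℂ) (M : Matrix (Fin k) (Fin l) ℂ) (n : ℕ) :
    (rmul D ^ n) (vecM M) = vecM (M * D ^ n) := by
  induction n with
  | zero => simp
  | succ n ih =>
    rw [pow_succ' (rmul D), _root_.mul_apply_eq_comp, ih, rmul_vec, Matrix.mul_assoc, ← pow_succ]

lemma block_pow_s9 (B11 : Matrix (Fin k) (Fin k) ℂ) (B22 : Matrix (Fin l) (Fin l) ℂ) (B12 : Matrix (Fin k) (Fin l) ℂ)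
    (n : ℕ) : ∃ Z : Matrix (Fin k) (Fin l) ℂ,
      fromBlocks B11 B12 0 B22 ^ n = fromBlocks (B11 ^ n) Z 0 (B22 ^ n) ∧
      vecM Z = (∫ t in (0:ℝ)..1, (n : ℂ) • seg (lmul B11) (rmul B22) t ^ (n - 1)) (vecM B12) := by
  induction n with
  | zero => exact ⟨0, by simp [Matrix.fromBlocks_one], by simp⟩
  | succ n ih =>
    obtain ⟨Z, h1, h2⟩ := ih
    refine ⟨B11 * Z + B12 * B22 ^ n, ?_, ?_⟩
    · rw [pow_succ', h1, Matrix.fromBlocks_multiply]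
      simp [pow_succ']
    · rw [Nat.add_sub_cancel, seg_rec (lr_comm B11 B22) n, map_add, ← lmul_vec, h2, _root_.add_apply, rmul_pow]
      rfl

lemma block_aeval (B11 : Matrix (Fin k) (Fin k) ℂ) (B22 : Matrix (Fin l) (Fin l) ℂ) (B12 : Matrix (Fin k) (Fin l) ℂ)
    (p : ℂ[X]) : vecM ((aeval (fromBlocks B11 B12 0 B22) p).toBlocks₁₂)
      = divDiff (lmul B11) (rmul B22) p (vecM B12) := by
  induction p using Polynomial.induction_on' with
  | add p q hp hq =>
    rw [divDiff_add, _root_.add_apply, ← hp, ← hq, map_add (aeval _), ← map_add vecM]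
    rfl
  | monomial n a =>
    obtain ⟨Z, h1, h2⟩ := block_pow_s9 B11 B22 B12 n
    rw [divDiff_monomial, aeval_monomial, ← Algebra.smul_def, h1, _root_.smul_apply, ← h2, ← map_smul]
    rfl

lemma dirRe_sum {ι : Type*} (s : Finset ι) (θ : ℝ) (f : ι → ℂ) : dirRe θ (∑ i ∈ s, f i) = ∑ i ∈ s, dirRe θ (f i) := by
  simp only [dirRe, Complex.re_sum, Complex.im_sum, Finset.mul_sum, Finset.sum_add_distrib]

lemma num_vec {E : Set ℂ} {R : ℝ} (hR : ∀ z ∈ E, ‖z‖ ≤ R) {B : Matrix (Fin k) (Fin k) ℂ} (hB : numRange B ⊆ E)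
    (θ : ℝ) (v : Fin k → ℂ) : dirRe θ (star v ⬝ᵥ B.mulVec v) ≤ suppFun E θ * ∑ i, ‖v i‖ ^ 2 := by
  set n := ∑ i, ‖v i‖ ^ 2 with hn
  have hv : star v ⬝ᵥ v = (n : ℂ) := by
    rw [hn, dotProduct]
    push_cast
    refine Finset.sum_congr rfl fun i _ => ?_
    rw [Pi.star_apply, Complex.star_def, ← Complex.normSq_eq_conj_mul_self, Complex.normSq_eq_norm_sq]
    push_cast; rfl
  have hn0 : 0 ≤ n := by positivity
  rcases hn0.eq_or_lt with h | h
  · have hv0 : v = 0 := by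
      funext i
      have := (Finset.sum_eq_zero_iff_of_nonneg (fun i _ => by positivity)).1 (hn.symm.trans h.symm) i (Finset.mem_univ i)
      simpa using this
    rw [← h, hv0]
    simp [dirRe]
  · set a : ℝ := (Real.sqrt n)⁻¹ with ha
    have haa : a * a * n = 1 := by
      rw [ha]
      have := Real.mul_self_sqrt hn0
      have h2 : Real.sqrt n ≠ 0 := (Real.sqrt_pos.2 h).ne'
      field_simp
      nlinarith
    have hs : ∀ w : Fin k → ℂ, star ((a : ℂ) • v) ⬝ᵥ ((a : ℂ) • w) = ((a * a : ℝ) : ℂ) * (star v ⬝ᵥ w) := by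
      intro w
      rw [star_smul, smul_dotProduct, dotProduct_smul, Complex.star_def, Complex.conj_ofReal, smul_smul]
      push_cast; rfl
    have hmem : ((a * a : ℝ) : ℂ) * (star v ⬝ᵥ B.mulVec v) ∈ E := by
      apply hB
      refine ⟨(a : ℂ) • v, ?_, ?_⟩
      · rw [hs, hv, ← Complex.ofReal_mul, haa, Complex.ofReal_one]
      · rw [Matrix.mulVec_smul, hs]
    have h1 := le_supp hR θ hmem
    have h2 : dirRe θ (((a * a : ℝ) : ℂ) * (star v ⬝ᵥ B.mulVec v)) = (a * a) * dirRe θ (star v ⬝ᵥ B.mulVec v) := by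
      simp only [dirRe, Complex.re_ofReal_mul, Complex.im_ofReal_mul]; ring
    rw [h2] at h1
    have h3 := mul_le_mul_of_nonneg_right h1 hn0
    calc _ = a * a * dirRe θ (star v ⬝ᵥ B.mulVec v) * n := by linear_combination (-dirRe θ (star v ⬝ᵥ B.mulVec v)) * haa
      _ ≤ _ := h3

lemma lmul_num {E : Set ℂ} {R : ℝ} (hR : ∀ z ∈ E, ‖z‖ ≤ R) {B : Matrix (Fin k) (Fin k) ℂ} (hB : numRange B ⊆ E)
    (θ : ℝ) (y : EuclideanSpace ℂ (Fin k × Fin l)) : dirRe θ (inner ℂ y (lmul B y)) ≤ suppFun E θ * ‖y‖ ^ 2 := by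
  obtain ⟨M, rfl⟩ := vecM.surjective y
  have h1 : inner ℂ (vecM M) (lmul B (vecM M)) = ∑ j, star (fun i => M i j) ⬝ᵥ B.mulVec (fun i => M i j) := by
    rw [lmul_vec, PiLp.inner_apply, Fintype.sum_prod_type_right]
    refine Finset.sum_congr rfl fun j _ => Finset.sum_congr rfl fun i _ => ?_
    rw [vecM_apply, vecM_apply, RCLike.inner_apply, mul_comm]
    rfl
  have h2 : ‖vecM M‖ ^ 2 = ∑ j, ∑ i, ‖M i j‖ ^ 2 := by
    rw [EuclideanSpace.norm_sq_eq, Fintype.sum_prod_type_right]; rfl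
  rw [h1, h2, dirRe_sum, Finset.mul_sum]
  exact Finset.sum_le_sum fun j _ => num_vec hR hB θ _

lemma rmul_num {E : Set ℂ} {R : ℝ} (hR : ∀ z ∈ E, ‖z‖ ≤ R) {B : Matrix (Fin l) (Fin l) ℂ} (hB : numRange B ⊆ E)
    (θ : ℝ) (y : EuclideanSpace ℂ (Fin k × Fin l)) : dirRe θ (inner ℂ y (rmul B y)) ≤ suppFun E θ * ‖y‖ ^ 2 := by
  obtain ⟨M, rfl⟩ := vecM.surjective y
  have h1 : inner ℂ (vecM M) (rmul B (vecM M)) = ∑ i, star (star (M i)) ⬝ᵥ B.mulVec (star (M i)) := by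
    rw [rmul_vec, PiLp.inner_apply, Fintype.sum_prod_type]
    refine Finset.sum_congr rfl fun i _ => ?_
    rw [star_star, Matrix.dotProduct_mulVec]
    refine Finset.sum_congr rfl fun j _ => ?_
    rw [vecM_apply, vecM_apply, RCLike.inner_apply]
    rfl
  have h2 : ‖vecM M‖ ^ 2 = ∑ i, ∑ j, ‖star (M i) j‖ ^ 2 := by
    rw [EuclideanSpace.norm_sq_eq, Fintype.sum_prod_type]
    simp [vecM_apply]
  rw [h1, h2, dirRe_sum, Finset.mul_sum]
  exact Finset.sum_le_sum fun j _ => num_vec hR hB θ _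

lemma seg_num {E : Set ℂ} {R : ℝ} (hR : ∀ z ∈ E, ‖z‖ ≤ R) {B : Matrix (Fin k) (Fin k) ℂ} (hB : numRange B ⊆ E)
    {D : Matrix (Fin l) (Fin l) ℂ} (hD : numRange D ⊆ E)
    (θ : ℝ) {t : ℝ} (h0 : 0 ≤ t) (h1 : t ≤ 1) (y : EuclideanSpace ℂ (Fin k × Fin l)) :
    dirRe θ (inner ℂ y (seg (lmul B) (rmul D) t y)) ≤ suppFun E θ * ‖y‖ ^ 2 := by
  have hl := lmul_num hR hB θ y
  have hr := rmul_num hR hD θ y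
  have e : dirRe θ (inner ℂ y (seg (lmul B) (rmul D) t y)) =
      t * dirRe θ (inner ℂ y (lmul B y)) + (1 - t) * dirRe θ (inner ℂ y (rmul D y)) := by
    rw [seg, _root_.add_apply, _root_.smul_apply, _root_.sub_apply, inner_add_right, inner_smul_right, inner_sub_right]
    simp only [dirRe, Complex.add_re, Complex.add_im, Complex.re_ofReal_mul, Complex.im_ofReal_mul, Complex.sub_re,
      Complex.sub_im]
    ring
  rw [e]
  nlinarith

lemma frob_empty (M : Matrix (Fin k) (Fin l) ℂ) (h : k = 0 ∨ l = 0) : frobNorm M = 0 := by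
  rcases h with rfl | rfl <;> simp [frobNorm]

lemma numRange_nonempty (hk : k ≠ 0) (B : Matrix (Fin k) (Fin k) ℂ) : (numRange B).Nonempty := by
  have : NeZero k := ⟨hk⟩
  refine ⟨_, Pi.single (0 : Fin k) (1:ℂ), ?_, rfl⟩
  simp

end app5
/-- For a block upper triangular matrix `𝓑 = [[B₁₁, B₁₂], [0, B₂₂]]` and a
compact convex set `E` containing `W(B₁₁)` and `W(B₂₂)`, for every polynomial `p`:
`‖[p(𝓑)]₁₂‖_F ≤ (1+√2)² ⬝ sup_{z∈E} |p'(z)| ⬝ ‖B₁₂‖_F`. -/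
theorem stmt9 (k l : ℕ) (B11 : Matrix (Fin k) (Fin k) ℂ) (B22 : Matrix (Fin l) (Fin l) ℂ)
    (B12 : Matrix (Fin k) (Fin l) ℂ) (E : Set ℂ)
    (hEcompact : IsCompact E) (hEconvex : Convex ℝ E)
    (hB11 : numRange B11 ⊆ E) (hB22 : numRange B22 ⊆ E) :
    ∀ p : Polynomial ℂ,
      frobNorm ((aeval (Matrix.fromBlocks B11 B12 0 B22) p).toBlocks₁₂) ≤
        (1 + Real.sqrt 2) ^ 2 *
          sSup ((fun z => ‖(Polynomial.derivative p).eval z‖) '' E) * frobNorm B12 := by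
  intro p
  by_cases hkl : k = 0 ∨ l = 0
  · rw [frob_empty _ hkl, frob_empty _ hkl, mul_zero]
  push Not at hkl
  obtain ⟨z0, hz0⟩ := numRange_nonempty hkl.1 B11
  have hne : E.Nonempty := ⟨z0, hB11 hz0⟩
  obtain ⟨R, hR⟩ := hEcompact.isBounded.exists_norm_le
  set M := sSup ((fun z => ‖(Polynomial.derivative p).eval z‖) '' E) with hM
  have hb : ∀ z ∈ E, ‖(Polynomial.derivative p).eval z‖ ≤ M := fun z hz =>
    le_csSup ((hEcompact.image ((Polynomial.derivative p).continuous.norm)).bddAbove) ⟨z, hz, rfl⟩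
  have hM0 : 0 ≤ M := (norm_nonneg _).trans (hb z0 (hB11 hz0))
  have h1 : ‖divDiff (lmul (l := l) B11) (rmul (k := k) B22) p‖ ≤ 3 * M := by
    have := intervalIntegral.norm_integral_le_of_norm_le_const (a := 0) (b := 1)
      (f := fun t => aeval (seg (lmul (l := l) B11) (rmul (k := k) B22) t) (derivative p)) (C := 3 * M) (by
        intro t ht
        rw [Set.uIoc_of_le zero_le_one] at ht
        exact works_three hEcompact hEconvex hne (fun θ y => seg_num hR hB11 hB22 θ ht.1.le ht.2 y) _ _ hb)
    simpa [divDiff] using this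
  rw [← vecM_norm, ← vecM_norm, block_aeval]
  have h2 : (3:ℝ) ≤ (1 + Real.sqrt 2) ^ 2 := by
    have := Real.sq_sqrt (show (0:ℝ) ≤ 2 by norm_num)
    nlinarith [Real.sqrt_nonneg 2]
  refine (ContinuousLinearMap.le_opNorm _ _).trans ?_
  gcongr
  exact h1.trans (by gcongr)
end
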